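/- Let d = 3, let p > 5 be a real number, and let m ≥ 40 be an integer. Then there exists a defocusing smooth potential F : ℝ^m → ℝ that is homogeneous of order p+1 outside of the unit ball, and a smooth choice of initial data u₀, u₁ : ℝ³ → ℝ^m, such that there is no global smooth solution u : ℝ^{1+3} → ℝ^m of the nonlinear wave system □u = (∇F)(u) with u(0,·) = u₀ and ∂_t u(0,·) = u₁. -/

import Mathlib

open Real MeasureTheory
open scoped RealInnerProductSpace

noncomputable section

/-- Spacetime `ℝ^{1+d}` realised as `Fin (d+1) → ℝ`; coordinate `0` is the time `t`,
coordinates `i.succ` are the spatial coordinates `x_i`. -/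
abbrev Sp (d : ℕ) := Fin (d + 1) → ℝ

/-- The Euclidean target space `ℝ^m`. -/
abbrev Em (m : ℕ) := EuclideanSpace ℝ (Fin m)

/-- The coordinate partial derivative `∂_α`. -/
def pd {d : ℕ} {E : Type*} [NormedAddCommGroup E] [NormedSpace ℝ E]
    (α : Fin (d + 1)) (f : Sp d → E) : Sp d → E :=
  fun x => fderiv ℝ f x (Pi.single α 1)

/-- The d'Alembertian `□ = -∂_t² + ∑_i ∂_{x_i}²`. -/
def dAlembert {d : ℕ} {E : Type*} [NormedAddCommGroup E] [NormedSpace ℝ E]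
    (f : Sp d → E) : Sp d → E :=
  fun x => -(pd 0 (pd 0 f) x) + ∑ i : Fin d, pd i.succ (pd i.succ f) x

/-- The (truncated, solid) light cone `Γ_d = {(t,x) : t > 0, |x| ≤ t}`,
with `|x|` the Euclidean norm. -/
def Cone (d : ℕ) : Set (Sp d) :=
  {y | 0 < y 0 ∧ ∑ i : Fin d, (y i.succ) ^ 2 ≤ (y 0) ^ 2}

theorem pd_contDiff {d : ℕ} {E : Type*} [NormedAddCommGroup E] [NormedSpace ℝ E]
    {f : Sp d → E} (hf : ContDiff ℝ (⊤ : ℕ∞) f) (α : Fin (d + 1)) :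
    ContDiff ℝ (⊤ : ℕ∞) (pd α f) :=
  (hf.fderiv_right (m := (⊤ : ℕ∞)) (by simp)).clm_apply contDiff_const

theorem pd_comm {d : ℕ} {E : Type*} [NormedAddCommGroup E] [NormedSpace ℝ E]
    {f : Sp d → E} (hf : ContDiff ℝ (⊤ : ℕ∞) f) (α β : Fin (d + 1)) (y : Sp d) :
    pd α (pd β f) y = pd β (pd α f) y := by
  have hd : Differentiable ℝ (fderiv ℝ f) :=
    (hf.fderiv_right (m := (⊤ : ℕ∞)) (by simp)).differentiable (by simp)
  have key : ∀ γ δ, pd γ (pd δ f) y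
      = fderiv ℝ (fderiv ℝ f) y (Pi.single γ 1) (Pi.single δ 1) := by
    intro γ δ
    unfold pd
    rw [fderiv_clm_apply (hd y) (differentiableAt_const _)]
    simp
  have hs : IsSymmSndFDerivAt ℝ f y :=
    (hf.contDiffAt).isSymmSndFDerivAt (by simp; norm_cast)
  rw [key, key]
  exact hs _ _

theorem setIntegral_pd_eq_zero {d : ℕ} {Y : Sp d → ℝ} (hY : ContDiff ℝ 1 Y)
    (hc : HasCompactSupport Y) (h0 : ∀ y : Sp d, y 0 = 0 → Y y = 0)
    (h1 : ∀ y : Sp d, y 0 = 0 → fderiv ℝ Y y = 0) (α : Fin (d + 1)) :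
    ∫ y in {y : Sp d | 0 ≤ y 0}, pd α Y y = 0 := by
  set H : Set (Sp d) := {y | 0 ≤ y 0} with hH
  have hHc : IsClosed H := isClosed_le continuous_const (continuous_apply 0)
  have hderiv : ∀ y, HasFDerivAt (H.indicator Y) (H.indicator (fderiv ℝ Y) y) y := by
    intro y
    have hYy := (hY.differentiable (by simp) y).hasFDerivAt
    rcases lt_trichotomy (y 0) 0 with h | h | h
    · have hn : y ∉ H := by simp [hH, h]
      rw [Set.indicator_of_notMem hn]
      refine (hasFDerivAt_const (0 : ℝ) y).congr_of_eventuallyEq ?_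
      filter_upwards [hHc.isOpen_compl.mem_nhds hn] with z hz
      exact Set.indicator_of_notMem hz _
    · have hm : y ∈ H := by simp [hH, h]
      rw [Set.indicator_of_mem hm, h1 y h]
      rw [h1 y h] at hYy
      rw [hasFDerivAt_iff_isLittleO_nhds_zero] at hYy ⊢
      refine Asymptotics.IsBigO.trans_isLittleO (Asymptotics.IsBigO.of_bound 1 ?_) hYy
      refine Filter.Eventually.of_forall fun z => ?_
      rw [Set.indicator_of_mem hm, h0 y h]
      by_cases hz : y + z ∈ H
      · simp [Set.indicator_of_mem hz]
      · simp [Set.indicator_of_notMem hz]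
    · have hm : y ∈ H := by simp [hH, h.le]
      rw [Set.indicator_of_mem hm]
      refine hYy.congr_of_eventuallyEq ?_
      have : {z : Sp d | 0 < z 0} ∈ nhds y :=
        (isOpen_lt continuous_const (continuous_apply 0)).mem_nhds h
      filter_upwards [this] with z hz
      have hzH : z ∈ H := (show (0 : ℝ) < z 0 from hz).le
      exact Set.indicator_of_mem hzH _
  have hcont : Continuous (fderiv ℝ Y) := hY.continuous_fderiv (by simp)
  have hInt : Integrable (H.indicator Y) :=
    (hY.continuous.integrable_of_hasCompactSupport hc).indicator hHc.measurableSet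
  have hpdc : Continuous (pd α Y) := hcont.clm_apply continuous_const
  have hInt' : Integrable (H.indicator (pd α Y)) := by
    refine (hpdc.integrable_of_hasCompactSupport ?_).indicator hHc.measurableSet
    exact (hc.fderiv (𝕜 := ℝ)).comp_left (g := fun L : Sp d →L[ℝ] ℝ => L (Pi.single α 1)) (by simp)
  have heq : ∀ y, (H.indicator (fderiv ℝ Y) y) (Pi.single α 1) = H.indicator (pd α Y) y := by
    intro y
    by_cases hy : y ∈ H
    · simp [Set.indicator_of_mem hy, pd]
    · simp [Set.indicator_of_notMem hy]
  have := integral_bilinear_hasFDerivAt_right_eq_neg_left_of_integrable (μ := volume)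
    (f := fun _ : Sp d => (1 : ℝ)) (f' := fun _ => 0) (g := H.indicator Y)
    (g' := H.indicator (fderiv ℝ Y)) (v := Pi.single α 1) (B := ContinuousLinearMap.mul ℝ ℝ)
    (by simp) (by simpa [heq] using hInt') (by simpa using hInt)
    (fun x _ => hasFDerivAt_const _ _) (fun x _ => hderiv x)
  simp only [heq, ContinuousLinearMap.mul_apply', one_mul] at this
  rw [integral_indicator hHc.measurableSet] at this
  simpa using this

theorem pd_mul {d : ℕ} {f g : Sp d → ℝ} {y : Sp d} (α : Fin (d + 1))
    (hf : DifferentiableAt ℝ f y) (hg : DifferentiableAt ℝ g y) :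
    pd α (fun z => f z * g z) y = pd α f y * g y + f y * pd α g y := by
  unfold pd
  rw [fderiv_fun_mul hf hg]
  simp
  ring

theorem pd_inner {d : ℕ} {E : Type*} [NormedAddCommGroup E] [InnerProductSpace ℝ E]
    {f g : Sp d → E} {y : Sp d} (α : Fin (d + 1))
    (hf : DifferentiableAt ℝ f y) (hg : DifferentiableAt ℝ g y) :
    pd α (fun z => ⟪f z, g z⟫) y = ⟪f y, pd α g y⟫ + ⟪pd α f y, g y⟫ := by
  unfold pd
  rw [fderiv_inner_apply ℝ hf hg]

theorem pd_comp {d : ℕ} {G : ℝ → ℝ} {φ : Sp d → ℝ} {y : Sp d} (α : Fin (d + 1))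
    (hG : DifferentiableAt ℝ G (φ y)) (hφ : DifferentiableAt ℝ φ y) :
    pd α (fun z => G (φ z)) y = deriv G (φ y) * pd α φ y := by
  unfold pd
  have := (hG.hasDerivAt.comp_hasFDerivAt y hφ.hasFDerivAt).fderiv
  simp only [Function.comp_def] at this
  rw [this]
  simp

theorem fderiv_inner_eq_zero {V E : Type*} [NormedAddCommGroup V] [NormedSpace ℝ V]
    [NormedAddCommGroup E] [InnerProductSpace ℝ E]
    {f g : V → E} {y : V} (hf : DifferentiableAt ℝ f y) (hg : DifferentiableAt ℝ g y)
    (hf0 : f y = 0) (hg0 : g y = 0) :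
    fderiv ℝ (fun z => ⟪f z, g z⟫) y = 0 := by
  ext v
  rw [fderiv_inner_apply ℝ hf hg, hf0, hg0]
  simp

theorem pd_zero_coord {d : ℕ} (y : Sp d) (α : Fin (d + 1)) :
    pd α (fun z : Sp d => z 0) y = if α = 0 then 1 else 0 := by
  unfold pd
  have : HasFDerivAt (fun z : Sp d => z 0) (ContinuousLinearMap.proj (R := ℝ) 0) y :=
    (ContinuousLinearMap.proj (R := ℝ) (φ := fun _ : Fin (d + 1) => ℝ) 0).hasFDerivAt
  rw [this.fderiv]
  simp [Pi.single_apply, eq_comm]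

/-- The squared Euclidean norm of the spatial part of a spacetime point. -/
def radSq {d : ℕ} (y : Sp d) : ℝ := ∑ i : Fin d, y i.succ ^ 2

theorem radSq_contDiff {d : ℕ} : ContDiff ℝ (⊤ : ℕ∞) (radSq (d := d)) := by
  unfold radSq
  fun_prop

theorem pd_radSq {d : ℕ} (y : Sp d) (α : Fin (d + 1)) :
    pd α radSq y = if α = 0 then 0 else 2 * y α := by
  have hp : ∀ i : Fin d, HasFDerivAt (fun z : Sp d => z i.succ)
      (ContinuousLinearMap.proj (R := ℝ) (φ := fun _ : Fin (d + 1) => ℝ) i.succ) y := fun i =>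
    (ContinuousLinearMap.proj (R := ℝ) (φ := fun _ : Fin (d + 1) => ℝ) i.succ).hasFDerivAt
  have : HasFDerivAt (radSq (d := d)) (∑ i : Fin d, (2 * y i.succ) •
      (ContinuousLinearMap.proj (R := ℝ) (φ := fun _ : Fin (d + 1) => ℝ) i.succ)) y := by
    unfold radSq
    refine HasFDerivAt.fun_sum fun i _ => ?_
    simpa using (hp i).pow 2
  unfold pd
  rw [this.fderiv]
  simp only [_root_.sum_apply, _root_.smul_apply,
    ContinuousLinearMap.proj_apply, smul_eq_mul, Pi.single_apply]
  refine Fin.cases ?_ (fun j => ?_) α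
  · simp
  · simp [Fin.succ_inj]

theorem pd_sub {d : ℕ} {E : Type*} [NormedAddCommGroup E] [NormedSpace ℝ E]
    {f g : Sp d → E} {y : Sp d} (α : Fin (d + 1))
    (hf : DifferentiableAt ℝ f y) (hg : DifferentiableAt ℝ g y) :
    pd α (fun z => f z - g z) y = pd α f y - pd α g y := by
  unfold pd
  rw [fderiv_fun_sub hf hg]
  simp

/-- A smooth compactly supported weight living in the backward light cone with vertex `(R, 0)`. -/
theorem exists_cone_weight {d : ℕ} {R t : ℝ} (htR : t < R) (ht : 0 < t) (c : ℝ) :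
    ∃ ρ : Sp d → ℝ, ContDiff ℝ (⊤ : ℕ∞) ρ ∧ HasCompactSupport ρ ∧ (∀ y, 0 ≤ ρ y) ∧
      0 < ρ (Fin.cons t 0) ∧
      (∀ y : Sp d, ρ y ≠ 0 → y 0 ≤ R ∧ radSq y ≤ (R - y 0) ^ 2) ∧
      ∀ y : Sp d, 0 ≤ y 0 → ∃ (κ : ℝ) (n : Fin d → ℝ), 0 ≤ κ ∧ ∑ i, n i ^ 2 ≤ 1 ∧
        pd 0 ρ y = -κ - c * ρ y ∧ ∀ i, pd i.succ ρ y = -κ * n i := by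
  obtain ⟨δ, hδ, hδR⟩ : ∃ δ, 0 < δ ∧ δ < R - t := exists_between (by linarith)
  have hrad : ∀ y : Sp d, 0 ≤ radSq y := fun y => Finset.sum_nonneg fun i _ => sq_nonneg _
  have hpos : ∀ y : Sp d, 0 < δ ^ 2 + radSq y := fun y => by have := hrad y; positivity
  set T : ℝ → ℝ := fun s => Real.smoothTransition (s + 1) with hT
  have hTc : ContDiff ℝ (⊤ : ℕ∞) T :=
    Real.smoothTransition.contDiff.comp (contDiff_id.add contDiff_const)
  set φ : Sp d → ℝ := fun y => R - y 0 - √(δ ^ 2 + radSq y) with hφ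
  have hsq : ContDiff ℝ (⊤ : ℕ∞) fun y : Sp d => √(δ ^ 2 + radSq y) :=
    (contDiff_const.add radSq_contDiff).sqrt fun y => (hpos y).ne'
  have hφc : ContDiff ℝ (⊤ : ℕ∞) φ := by
    refine ContDiff.sub ?_ hsq
    fun_prop
  have hGc : ContDiff ℝ (⊤ : ℕ∞) expNegInvGlue := expNegInvGlue.contDiff
  have hEc : ContDiff ℝ (⊤ : ℕ∞) fun s : ℝ => exp (-c * s) := by fun_prop
  have h0c : ContDiff ℝ (⊤ : ℕ∞) fun y : Sp d => y 0 := by fun_prop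
  set ρ : Sp d → ℝ := fun y => T (y 0) * expNegInvGlue (φ y) * exp (-c * y 0) with hρ
  have hsqrt : ∀ y : Sp d, √(radSq y) ≤ √(δ ^ 2 + radSq y) := fun y =>
    Real.sqrt_le_sqrt (by nlinarith [sq_nonneg δ])
  have hsupp : ∀ y : Sp d, ρ y ≠ 0 → -1 ≤ y 0 ∧ y 0 ≤ R ∧ radSq y ≤ (R - y 0) ^ 2 := by
    intro y hy
    have h1 : T (y 0) ≠ 0 := fun h => hy (by simp [hρ, h])
    have h2 : expNegInvGlue (φ y) ≠ 0 := fun h => hy (by simp [hρ, h])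
    have h3 : 0 < φ y := by
      by_contra h
      exact h2 (expNegInvGlue.zero_of_nonpos (not_lt.1 h))
    have h4 : √(radSq y) < R - y 0 := by
      have := hsqrt y
      simp only [hφ] at h3
      linarith
    refine ⟨?_, ?_, ?_⟩
    · by_contra h
      exact h1 (Real.smoothTransition.zero_of_nonpos (by linarith))
    · linarith [Real.sqrt_nonneg (radSq y)]
    · rw [← Real.sq_sqrt (hrad y)]
      exact pow_le_pow_left₀ (Real.sqrt_nonneg _) h4.le 2
  refine ⟨ρ, ((hTc.comp h0c).mul (hGc.comp hφc)).mul (hEc.comp h0c), ?_, ?_, ?_, ?_, ?_⟩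
  · refine HasCompactSupport.intro (isCompact_Icc (a := fun _ : Fin (d + 1) => -(|R| + 1))
      (b := fun _ => |R| + 1)) fun y hy => ?_
    by_contra h
    obtain ⟨h1, h2, h3⟩ := hsupp y h
    apply hy
    have habs : ∀ α, |y α| ≤ |R| + 1 := by
      refine Fin.cases ?_ fun i => ?_
      · rw [abs_le]
        exact ⟨by linarith [abs_nonneg R], by linarith [le_abs_self R]⟩
      · refine abs_le_of_sq_le_sq (h := ?_) (by positivity)
        have : y i.succ ^ 2 ≤ radSq y :=
          Finset.single_le_sum (f := fun i : Fin d => y i.succ ^ 2)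
            (fun i _ => sq_nonneg _) (Finset.mem_univ i)
        refine this.trans (h3.trans ?_)
        exact pow_le_pow_left₀ (by linarith) (by linarith [le_abs_self R]) 2
    exact ⟨fun α => (abs_le.1 (habs α)).1, fun α => (abs_le.1 (habs α)).2⟩
  · intro y
    exact mul_nonneg (mul_nonneg (Real.smoothTransition.nonneg _) (expNegInvGlue.nonneg _))
      (exp_pos _).le
  · have h1 : T t = 1 := Real.smoothTransition.one_of_one_le (by linarith)
    have h2 : φ (Fin.cons t 0) = R - t - δ := by
      simp [hφ, radSq, Real.sqrt_sq hδ.le]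
    simp only [hρ, h2, Fin.cons_zero, h1]
    have := expNegInvGlue.pos_of_pos (x := R - t - δ) (by linarith)
    positivity
  · exact fun y hy => (hsupp y hy).2
  · intro y hy
    have hT1 : T (y 0) = 1 := Real.smoothTransition.one_of_one_le (by linarith)
    have hT' : deriv T (y 0) = 0 := by
      refine IsLocalMax.deriv_eq_zero (Filter.Eventually.of_forall fun z => ?_)
      rw [hT1]
      exact Real.smoothTransition.le_one _
    have dT := hTc.differentiable (by simp)
    have dG := hGc.differentiable (by simp)
    have dφ := hφc.differentiable (by simp)
    have dE := hEc.differentiable (by simp)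
    have d0 := h0c.differentiable (by simp)
    have dr := (radSq_contDiff (d := d)).differentiable (by simp)
    have hE' : deriv (fun s : ℝ => exp (-c * s)) (y 0) = -c * exp (-c * y 0) := by
      have := (((hasDerivAt_id (y 0)).const_mul (-c)).exp).deriv
      simp only [id] at this
      rw [this]
      ring
    set q := √(δ ^ 2 + radSq y) with hq
    have hqpos : 0 < q := Real.sqrt_pos.2 (hpos y)
    have hpφ : ∀ α, pd α φ y = -(if α = 0 then 1 else 0) - (1 / (2 * q)) * pd α radSq y := by
      intro α
      have hS : HasDerivAt (fun s => √(δ ^ 2 + s)) (1 / (2 * q)) (radSq y) := by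
        have := ((hasDerivAt_id (radSq y)).const_add (δ ^ 2)).sqrt (hpos y).ne'
        simpa using this
      have e1 : pd α (fun z : Sp d => √(δ ^ 2 + radSq z)) y = 1 / (2 * q) * pd α radSq y := by
        rw [pd_comp (G := fun s => √(δ ^ 2 + s)) α hS.differentiableAt (dr y), hS.deriv]
      have e2 : pd α (fun z : Sp d => R - z 0) y = -(if α = 0 then 1 else 0) := by
        rw [pd_sub α (differentiableAt_const _) (d0 y), pd_zero_coord]
        simp [pd]
      rw [hφ, pd_sub α (by fun_prop) (hsq.differentiable (by simp) y), e1, e2]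
    have hpρ : ∀ α, pd α ρ y = deriv expNegInvGlue (φ y) * pd α φ y * exp (-c * y 0)
        + (if α = 0 then 1 else 0) * (-c * ρ y) := by
      intro α
      have e1 := pd_comp (G := T) (φ := fun z : Sp d => z 0) α (dT _) (d0 y)
      have e2 := pd_comp (G := expNegInvGlue) (φ := φ) α (dG _) (dφ y)
      have e3 := pd_comp (G := fun s : ℝ => exp (-c * s)) (φ := fun z : Sp d => z 0) α (dE _) (d0 y)
      have D1 : DifferentiableAt ℝ (fun z : Sp d => T (z 0)) y := (dT.comp d0) y
      have D2 : DifferentiableAt ℝ (fun z : Sp d => expNegInvGlue (φ z)) y := (dG.comp dφ) y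
      have D3 : DifferentiableAt ℝ (fun z : Sp d => exp (-c * z 0)) y := (dE.comp d0) y
      have D12 : DifferentiableAt ℝ (fun z : Sp d => T (z 0) * expNegInvGlue (φ z)) y := D1.mul D2
      rw [hρ, pd_mul α D12 D3, pd_mul α D1 D2, e1, e2, e3, hT', hE', hT1, pd_zero_coord]
      simp only [hT1]
      ring
    have hG' : 0 ≤ deriv expNegInvGlue (φ y) := expNegInvGlue.monotone.deriv_nonneg
    refine ⟨deriv expNegInvGlue (φ y) * exp (-c * y 0), fun i => y i.succ / q,
      by positivity, ?_, ?_, ?_⟩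
    · simp only [div_pow]
      rw [← Finset.sum_div, div_le_one (by positivity), hq, Real.sq_sqrt (hpos y).le]
      change radSq y ≤ _
      nlinarith [sq_nonneg δ]
    · rw [hpρ, hpφ, pd_radSq]
      simp
      ring
    · intro i
      rw [hpρ, hpφ, pd_radSq]
      simp
      field_simp

theorem pd_spatial_eq_zero {d : ℕ} {E : Type*} [NormedAddCommGroup E] [NormedSpace ℝ E]
    {f : Sp d → E} (hf : Differentiable ℝ f) (h0 : ∀ y : Sp d, y 0 = 0 → f y = 0)
    {y : Sp d} (hy : y 0 = 0) (i : Fin d) : pd i.succ f y = 0 := by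
  unfold pd
  rw [← (hf y).lineDeriv_eq_fderiv, lineDeriv]
  have : (fun s : ℝ => f (y + s • Pi.single i.succ 1)) = fun _ => 0 := by
    funext s
    apply h0
    simp [hy, (Fin.succ_ne_zero i).symm]
  rw [this]
  simp

theorem setIntegral_pd_mul_eq_zero {d : ℕ} {ρ f : Sp d → ℝ} (hρ : ContDiff ℝ (⊤ : ℕ∞) ρ)
    (hc : HasCompactSupport ρ) (hf : ContDiff ℝ (⊤ : ℕ∞) f)
    (h0 : ∀ y : Sp d, y 0 = 0 → f y = 0) (h1 : ∀ y : Sp d, y 0 = 0 → fderiv ℝ f y = 0)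
    (α : Fin (d + 1)) :
    IntegrableOn (pd α fun y => ρ y * f y) {y : Sp d | 0 ≤ y 0} ∧
      ∫ y in {y : Sp d | 0 ≤ y 0}, pd α (fun y => ρ y * f y) y = 0 := by
  have hY : ContDiff ℝ (⊤ : ℕ∞) fun y => ρ y * f y := hρ.mul hf
  have hcY : HasCompactSupport fun y => ρ y * f y := hc.mul_right
  refine ⟨?_, setIntegral_pd_eq_zero (hY.of_le (by simp)) hcY (fun y hy => by simp [h0 y hy])
    (fun y hy => ?_) α⟩
  · refine ((pd_contDiff hY α).continuous.integrable_of_hasCompactSupport ?_).integrableOn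
    exact (hcY.fderiv (𝕜 := ℝ)).comp_left (g := fun L : Sp d →L[ℝ] ℝ => L (Pi.single α 1)) (by simp)
  · rw [fderiv_fun_mul (hρ.differentiable (by simp) y) (hf.differentiable (by simp) y),
      h0 y hy, h1 y hy]
    simp

/-- Uniqueness in a backward light cone, by the energy method. -/
theorem eq_zero_of_dAlembert_le {d : ℕ} {E : Type*} [NormedAddCommGroup E]
    [InnerProductSpace ℝ E] {w : Sp d → E} (hw : ContDiff ℝ (⊤ : ℕ∞) w) {R C t : ℝ} (hC : 0 ≤ C)
    (hbox : ∀ y : Sp d, 0 ≤ y 0 → y 0 ≤ R → radSq y ≤ (R - y 0) ^ 2 →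
      ‖dAlembert w y‖ ≤ C * ‖w y‖)
    (h0 : ∀ y : Sp d, y 0 = 0 → w y = 0) (h1 : ∀ y : Sp d, y 0 = 0 → pd 0 w y = 0)
    (ht : 0 < t) (htR : t < R) : w (Fin.cons t 0) = 0 := by
  obtain ⟨ρ, hρ, hρc, hρ0, hρt, hρs, hρd⟩ := exists_cone_weight (d := d) htR ht (C + 2)
  have dw := hw.differentiable (by simp)
  have hp : ∀ α, ContDiff ℝ (⊤ : ℕ∞) (pd α w) := pd_contDiff hw
  have dp : ∀ α, Differentiable ℝ (pd α w) := fun α => (hp α).differentiable (by simp)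
  have hp0 : ∀ α, ∀ y : Sp d, y 0 = 0 → pd α w y = 0 := fun α y hy => by
    refine Fin.cases (h1 y hy) (fun i => pd_spatial_eq_zero dw h0 hy i) α
  set e : Sp d → ℝ := fun y => ⟪w y, w y⟫ + (⟪pd 0 w y, pd 0 w y⟫
    + ∑ i : Fin d, ⟪pd i.succ w y, pd i.succ w y⟫) with he
  have hec : ContDiff ℝ (⊤ : ℕ∞) e := (hw.inner ℝ hw).add
    (((hp 0).inner ℝ (hp 0)).add (ContDiff.sum fun i _ => (hp _).inner ℝ (hp _)))
  have hwn : ∀ y, 0 ≤ ⟪w y, w y⟫ := fun y => real_inner_self_nonneg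
  have hSn : ∀ y, 0 ≤ ∑ i : Fin d, ⟪pd i.succ w y, pd i.succ w y⟫ := fun y =>
    Finset.sum_nonneg fun i _ => real_inner_self_nonneg
  have he0 : ∀ y, 0 ≤ e y := fun y =>
    add_nonneg (hwn y) (add_nonneg real_inner_self_nonneg (hSn y))
  have he1 : ∀ y : Sp d, y 0 = 0 → e y = 0 := fun y hy => by simp [he, h0 y hy, hp0 _ y hy]
  have he2 : ∀ y : Sp d, y 0 = 0 → fderiv ℝ e y = 0 := fun y hy =>
    IsLocalMin.fderiv_eq_zero (Filter.Eventually.of_forall fun z => by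
      rw [he1 y hy]; exact he0 z)
  set f : Fin d → Sp d → ℝ := fun i y => ⟪pd 0 w y, pd i.succ w y⟫ with hf
  have hfc : ∀ i, ContDiff ℝ (⊤ : ℕ∞) (f i) := fun i => (hp 0).inner ℝ (hp _)
  have hf2 : ∀ i, ∀ y : Sp d, y 0 = 0 → fderiv ℝ (f i) y = 0 := fun i y hy =>
    fderiv_inner_eq_zero (dp 0 y) (dp _ y) (hp0 _ y hy) (hp0 _ y hy)
  obtain ⟨ie, he3⟩ := setIntegral_pd_mul_eq_zero hρ hρc hec he1 he2 0
  have hI := fun i => setIntegral_pd_mul_eq_zero hρ hρc (hfc i)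
    (fun y hy => by simp [hf, hp0 _ y hy]) (hf2 i) i.succ
  set H : Set (Sp d) := {y | 0 ≤ y 0} with hH
  have hHm : MeasurableSet H := (isClosed_le continuous_const (continuous_apply 0)).measurableSet
  have hρe : Continuous fun y => ρ y * e y := hρ.continuous.mul hec.continuous
  have iρe : IntegrableOn (fun y => ρ y * e y) H :=
    (hρe.integrable_of_hasCompactSupport hρc.mul_right).integrableOn
  have dρ := hρ.differentiable (by simp)
  have pointwise : ∀ y ∈ H, ρ y * e y ≤ -(pd 0 (fun z => ρ z * e z) y)
      + ∑ i : Fin d, 2 * pd i.succ (fun z => ρ z * f i z) y := by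
    intro y hy
    obtain ⟨κ, n, hκ, hn, hd0, hdi⟩ := hρd y hy
    have e0 : pd 0 e y = 2 * ⟪pd 0 w y, w y⟫ + (2 * ⟪pd 0 w y, pd 0 (pd 0 w) y⟫
        + ∑ i : Fin d, 2 * ⟪pd i.succ w y, pd 0 (pd i.succ w) y⟫) := by
      have hF := ((dw y).hasFDerivAt.inner ℝ (dw y).hasFDerivAt).add
        (((dp 0 y).hasFDerivAt.inner ℝ (dp 0 y).hasFDerivAt).add
        (HasFDerivAt.fun_sum (u := Finset.univ) fun (i : Fin d) _ =>
          (dp i.succ y).hasFDerivAt.inner ℝ (dp i.succ y).hasFDerivAt))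
      have : fderiv ℝ e y = _ := hF.fderiv
      unfold pd at this ⊢
      rw [this]
      simp [_root_.sum_apply, real_inner_comm, two_mul]
    have ei : ∀ i, pd i.succ (f i) y = ⟪pd 0 w y, pd i.succ (pd i.succ w) y⟫
        + ⟪pd i.succ w y, pd 0 (pd i.succ w) y⟫ := fun i => by
      rw [hf, pd_inner _ (dp 0 y) (dp _ y), pd_comm hw i.succ 0, real_inner_comm (pd i.succ w y)]
    have hbx : ρ y * (⟪pd 0 w y, w y⟫ - ⟪pd 0 w y, dAlembert w y⟫)
        ≤ ρ y * ((C + 1) * (‖pd 0 w y‖ * ‖w y‖)) := by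
      by_cases hz : ρ y = 0
      · simp [hz]
      obtain ⟨hyR, hyr⟩ := hρs y hz
      refine mul_le_mul_of_nonneg_left ?_ (hρ0 y)
      rw [← inner_sub_right]
      refine (real_inner_le_norm _ _).trans ?_
      have := (norm_sub_le (w y) (dAlembert w y)).trans
        (add_le_add_right (hbox y hy hyR hyr) _)
      nlinarith [norm_nonneg (pd 0 w y)]
    have hnf : ∑ i, n i * f i y * 2 ≤ e y - ⟪w y, w y⟫ := by
      have : ∀ i, n i * f i y * 2 ≤ n i ^ 2 * ⟪pd 0 w y, pd 0 w y⟫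
          + ⟪pd i.succ w y, pd i.succ w y⟫ := fun i => by
        have := real_inner_self_nonneg (x := n i • pd 0 w y - pd i.succ w y)
        rw [real_inner_sub_sub_self, inner_smul_left, inner_smul_left, inner_smul_right] at this
        simp only [hf]
        simp at this
        simp
        nlinarith
      refine (Finset.sum_le_sum fun i _ => this i).trans ?_
      rw [Finset.sum_add_distrib, ← Finset.sum_mul]
      have := mul_le_mul_of_nonneg_right hn (real_inner_self_nonneg (x := pd 0 w y))
      simp only [he]
      linarith
    have hbox' : ⟪pd 0 w y, dAlembert w y⟫ = -⟪pd 0 w y, pd 0 (pd 0 w) y⟫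
        + ∑ i : Fin d, ⟪pd 0 w y, pd i.succ (pd i.succ w) y⟫ := by
      rw [dAlembert, inner_add_right, inner_neg_right, inner_sum]
    have hsum : ∑ i : Fin d, 2 * pd i.succ (fun z => ρ z * f i z) y
        = -κ * (∑ i, n i * f i y * 2) + 2 * ρ y * (∑ i, pd i.succ (f i) y) := by
      rw [Finset.mul_sum, Finset.mul_sum, ← Finset.sum_add_distrib]
      refine Finset.sum_congr rfl fun i _ => ?_
      rw [pd_mul _ (dρ y) ((hfc i).differentiable (by simp) y), hdi]
      ring
    rw [hsum, pd_mul _ (dρ y) (hec.differentiable (by simp) y), hd0, e0]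
    simp only [ei, Finset.sum_add_distrib, ← Finset.mul_sum]
    have hk := mul_le_mul_of_nonneg_left hnf hκ
    have hk2 := mul_nonneg hκ (hwn y)
    have hq : 2 * (‖pd 0 w y‖ * ‖w y‖) ≤ e y := by
      have := hSn y
      simp only [he]
      rw [real_inner_self_eq_norm_sq, real_inner_self_eq_norm_sq]
      nlinarith [sq_nonneg (‖pd 0 w y‖ - ‖w y‖)]
    have hq2 := mul_le_mul_of_nonneg_left hq (mul_nonneg (hρ0 y) (by linarith : 0 ≤ C + 1))
    rw [hbox'] at hbx
    nlinarith
  have hle : ∫ y in H, ρ y * e y ≤ 0 := by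
    have i2 : IntegrableOn (fun y => ∑ i : Fin d, 2 * pd i.succ (fun z => ρ z * f i z) y) H :=
      integrable_finsetSum _ fun i _ => (hI i).1.const_mul 2
    have := setIntegral_mono_on iρe (ie.neg.add i2) hHm pointwise
    refine this.trans (le_of_eq ?_)
    rw [integral_add' ie.neg i2, integral_neg', he3, integral_finsetSum _
      fun i _ => (hI i).1.const_mul 2]
    simp only [integral_const_mul, (hI _).2]
    simp
  have hnn : ∀ y, 0 ≤ ρ y * e y := fun y => mul_nonneg (hρ0 y) (he0 y)
  have hae : (fun y => ρ y * e y) =ᵐ[volume.restrict H] 0 :=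
    (setIntegral_eq_zero_iff_of_nonneg_ae (Filter.Eventually.of_forall hnn) iρe).1
      (le_antisymm hle (integral_nonneg hnn))
  have hO : IsOpen {y : Sp d | 0 < y 0} := isOpen_lt continuous_const (continuous_apply 0)
  have hae' : (fun y => ρ y * e y) =ᵐ[volume.restrict {y : Sp d | 0 < y 0}] fun _ => 0 :=
    ae_restrict_of_ae_restrict_of_subset (fun y (hy : 0 < y 0) => hy.le) hae
  have hz := Measure.eqOn_open_of_ae_eq hae' hO hρe.continuousOn continuousOn_const
    (show (Fin.cons t 0 : Sp d) ∈ {y : Sp d | 0 < y 0} by simpa using ht)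
  have hez : e (Fin.cons t 0) = 0 := (mul_eq_zero.1 hz).resolve_left hρt.ne'
  have : ⟪w (Fin.cons t 0), w (Fin.cons t 0)⟫ = 0 := by
    refine le_antisymm ?_ (hwn _)
    have h2 := hSn (Fin.cons t 0)
    have h3 := real_inner_self_nonneg (x := pd 0 w (Fin.cons t 0))
    simp only [he] at hez
    linarith
  exact inner_self_eq_zero.1 this

theorem Filter.EventuallyEq.pd {d : ℕ} {E : Type*} [NormedAddCommGroup E] [NormedSpace ℝ E]
    {f g : Sp d → E} {y : Sp d} (h : f =ᶠ[nhds y] g) (α : Fin (d + 1)) :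
    pd α f =ᶠ[nhds y] pd α g := by
  filter_upwards [h.fderiv (𝕜 := ℝ)] with z hz
  simp only [_root_.pd, hz]

theorem Filter.EventuallyEq.dAlembert_eq {d : ℕ} {E : Type*} [NormedAddCommGroup E]
    [NormedSpace ℝ E] {f g : Sp d → E} {y : Sp d} (h : f =ᶠ[nhds y] g) :
    dAlembert f y = dAlembert g y := by
  have : ∀ α, _root_.pd α (_root_.pd α f) y = _root_.pd α (_root_.pd α g) y := fun α =>
    ((h.pd α).pd α).eq_of_nhds
  simp only [dAlembert, this]

theorem dAlembert_sub {d : ℕ} {E : Type*} [NormedAddCommGroup E] [NormedSpace ℝ E]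
    {f g : Sp d → E} (hf : ContDiff ℝ (⊤ : ℕ∞) f) (hg : ContDiff ℝ (⊤ : ℕ∞) g) (y : Sp d) :
    dAlembert (fun z => f z - g z) y = dAlembert f y - dAlembert g y := by
  have h1 : ∀ α, pd α (fun z => f z - g z) = fun z => pd α f z - pd α g z := fun α =>
    funext fun z => pd_sub α (hf.differentiable (by simp) z) (hg.differentiable (by simp) z)
  have h2 : ∀ α, pd α (pd α fun z => f z - g z) y = pd α (pd α f) y - pd α (pd α g) y :=
    fun α => by
      rw [h1, pd_sub α ((pd_contDiff hf α).differentiable (by simp) y)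
        ((pd_contDiff hg α).differentiable (by simp) y)]
  simp only [dAlembert, h2, Finset.sum_sub_distrib]
  abel

theorem exists_gradient_lipschitz {m : ℕ} {F : Em m → ℝ} (hF : ContDiff ℝ (⊤ : ℕ∞) F) (r : ℝ) :
    ∃ C, 0 ≤ C ∧ ∀ v w : Em m, ‖v‖ ≤ r → ‖w‖ ≤ r →
      ‖gradient F v - gradient F w‖ ≤ C * ‖v - w‖ := by
  have hg : ContDiff ℝ (⊤ : ℕ∞) (fderiv ℝ F) := hF.fderiv_right (by simp)
  obtain ⟨C, hC⟩ := (isCompact_closedBall (0 : Em m) r).exists_bound_of_continuousOn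
    (hg.continuous_fderiv (by simp)).continuousOn
  refine ⟨max C 0, le_max_right _ _, fun v w hv hw => ?_⟩
  have : ‖fderiv ℝ F v - fderiv ℝ F w‖ ≤ max C 0 * ‖v - w‖ :=
    (convex_closedBall (0 : Em m) r).norm_image_sub_le_of_norm_fderiv_le (𝕜 := ℝ)
      (fun x _ => hg.differentiable (by simp) x) (fun x hx => (hC x hx).trans (le_max_left _ _))
      (by simpa using hw) (by simpa using hv)
  simpa only [gradient, ← map_sub, LinearIsometryEquiv.norm_map] using this

/-- If a local solution inside the backward light cone with vertex `(1, 0)` blows up at the vertex,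
its Cauchy data does not admit a global smooth solution. -/
theorem exists_data_without_global_solution {d m : ℕ} {F : Em m → ℝ}
    (hF : ContDiff ℝ (⊤ : ℕ∞) F) {φ : Sp d → Em m}
    (hsmooth : ∀ R < 1, ∃ U : Sp d → Em m, ContDiff ℝ (⊤ : ℕ∞) U ∧ ∀ y, y 0 < R → U y = φ y)
    (heq : ∀ y : Sp d, 0 ≤ y 0 → y 0 < 1 → radSq y ≤ (1 - y 0) ^ 2 →
      dAlembert φ y = gradient F (φ y))
    (hblow : ∀ K, ∃ t : ℝ, 0 < t ∧ t < 1 ∧ K < ‖φ (Fin.cons t 0)‖) :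
    ∃ u₀ u₁ : (Fin d → ℝ) → Em m, ContDiff ℝ (⊤ : ℕ∞) u₀ ∧ ContDiff ℝ (⊤ : ℕ∞) u₁ ∧
      ¬ ∃ u : Sp d → Em m, ContDiff ℝ (⊤ : ℕ∞) u ∧ (∀ y, dAlembert u y = gradient F (u y)) ∧
        (∀ x, u (Fin.cons 0 x) = u₀ x) ∧ (∀ x, pd 0 u (Fin.cons 0 x) = u₁ x) := by
  have hcons : ∀ s : ℝ, ContDiff ℝ (⊤ : ℕ∞) fun x : Fin d → ℝ => (Fin.cons s x : Sp d) := by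
    intro s
    rw [contDiff_pi]
    refine Fin.cases ?_ fun i => ?_
    · simpa using contDiff_const
    · simpa using contDiff_apply ℝ ℝ i
  have hconst : Continuous fun s : ℝ => (Fin.cons s 0 : Sp d) := by
    rw [continuous_pi_iff]
    refine Fin.cases ?_ fun i => ?_
    · simpa using continuous_id'
    · simpa using continuous_const
  have hnhds : ∀ {R : ℝ} {U : Sp d → Em m}, (∀ y, y 0 < R → U y = φ y) →
      ∀ y : Sp d, y 0 < R → U =ᶠ[nhds y] φ := fun {R U} h y hy => by
    filter_upwards [(isOpen_lt (continuous_apply 0) continuous_const).mem_nhds hy] with z hz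
    exact h z hz
  obtain ⟨U₁, hU₁, hU₁φ⟩ := hsmooth (1 / 2) (by norm_num)
  refine ⟨fun x => U₁ (Fin.cons 0 x), fun x => pd 0 U₁ (Fin.cons 0 x), hU₁.comp (hcons 0),
    (pd_contDiff hU₁ 0).comp (hcons 0), ?_⟩
  rintro ⟨u, hu, hueq, hu0, hu1⟩
  obtain ⟨K, hK⟩ := (isCompact_Icc (a := (0 : ℝ)) (b := 1)).exists_bound_of_continuousOn
    (f := fun s : ℝ => u (Fin.cons s 0)) (hu.continuous.comp hconst).continuousOn
  obtain ⟨t, ht0, ht1, htK⟩ := hblow K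
  obtain ⟨R, htR, hR1⟩ := exists_between ht1
  obtain ⟨R', hRR', hR'1⟩ := exists_between hR1
  obtain ⟨U, hU, hUφ⟩ := hsmooth R' hR'1
  have hUn := hnhds hUφ
  have hUn₁ := hnhds hU₁φ
  have hcont : Continuous fun y : Sp d => ‖u y‖ + ‖U y‖ :=
    hu.continuous.norm.add hU.continuous.norm
  have hbox : ∃ r, ∀ y : Sp d, 0 ≤ y 0 → y 0 ≤ R → radSq y ≤ (R - y 0) ^ 2 →
      ‖u y‖ ≤ r ∧ ‖U y‖ ≤ r := by
    obtain ⟨r, hr⟩ := (isCompact_closedBall (0 : Sp d) R).exists_bound_of_continuousOn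
      hcont.continuousOn
    refine ⟨r, fun y h0 hR h => ?_⟩
    have hy : y ∈ Metric.closedBall (0 : Sp d) R := by
      rw [mem_closedBall_zero_iff, pi_norm_le_iff_of_nonneg (h0.trans hR)]
      refine Fin.cases ?_ fun i => ?_
      · rwa [Real.norm_of_nonneg h0]
      · rw [Real.norm_eq_abs]
        refine abs_le_of_sq_le_sq ?_ (h0.trans hR)
        have : y i.succ ^ 2 ≤ radSq y :=
          Finset.single_le_sum (f := fun i : Fin d => y i.succ ^ 2)
            (fun i _ => sq_nonneg _) (Finset.mem_univ i)
        exact this.trans (h.trans (pow_le_pow_left₀ (by linarith) (by linarith) 2))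
    have := (le_abs_self _).trans (hr y hy)
    constructor <;> linarith [norm_nonneg (u y), norm_nonneg (U y)]
  obtain ⟨r, hr⟩ := hbox
  obtain ⟨C, hC, hlip⟩ := exists_gradient_lipschitz hF r
  have hzero := eq_zero_of_dAlembert_le (w := fun y => u y - U y) (hu.sub hU) (R := R) hC
    (fun y h0 hR h => by
      obtain ⟨ha, hb⟩ := hr y h0 hR h
      have hy : y 0 < R' := by linarith
      rw [dAlembert_sub hu hU, hueq, (hUn y hy).dAlembert_eq,
        heq y h0 (by linarith) (h.trans (pow_le_pow_left₀ (by linarith) (by linarith) 2)),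
        ← hUφ y hy]
      exact hlip _ _ ha hb)
    (fun y hy => by
      have h1 : U y = U₁ y := by rw [hUφ y (by linarith), hU₁φ y (by linarith)]
      have h2 : u y = U₁ y := by
        have := hu0 (Fin.tail y)
        beta_reduce at this
        rwa [← hy, Fin.cons_self_tail] at this
      simp [h1, h2])
    (fun y hy => by
      have h1 : pd 0 U y = pd 0 U₁ y := ((hUn y (by linarith)).trans
        (hUn₁ y (by linarith)).symm).pd 0 |>.eq_of_nhds
      have h2 : pd 0 u y = pd 0 U₁ y := by
        have := hu1 (Fin.tail y)
        beta_reduce at this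
        rwa [← hy, Fin.cons_self_tail] at this
      rw [pd_sub 0 (hu.differentiable (by simp) y) (hU.differentiable (by simp) y), h1, h2,
        sub_self])
    ht0 htR
  rw [sub_eq_zero, hUφ _ (by simpa using htR.trans hRR')] at hzero
  have := hK t ⟨ht0.le, ht1.le⟩
  simp only [hzero] at this
  linarith

theorem hasDerivAt_sum_mul_pow (c : ℕ → ℝ) (N : ℕ) (σ : ℝ) :
    HasDerivAt (fun x => ∑ n ∈ Finset.range (N + 1), c n * x ^ n)
      (∑ n ∈ Finset.range N, (n + 1) * c (n + 1) * σ ^ n) σ := by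
  have : HasDerivAt (fun x => ∑ n ∈ Finset.range (N + 1), c n * x ^ n)
      (∑ n ∈ Finset.range (N + 1), c n * (n * σ ^ (n - 1))) σ :=
    HasDerivAt.fun_sum fun n _ => (hasDerivAt_pow n σ).const_mul (c n)
  convert this using 1
  rw [Finset.sum_range_succ']
  simp only [Nat.cast_add, Nat.cast_one, add_tsub_cancel_right, Nat.cast_zero, zero_mul, mul_zero,
    add_zero]
  exact Finset.sum_congr rfl fun n _ => by ring

theorem mul_sum_succ_mul_pow (c : ℕ → ℝ) (N : ℕ) (σ : ℝ) :
    σ * ∑ n ∈ Finset.range N, (n + 1) * c (n + 1) * σ ^ n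
      = ∑ n ∈ Finset.range (N + 1), n * c n * σ ^ n := by
  rw [Finset.sum_range_succ', Finset.mul_sum]
  simp only [Nat.cast_add, Nat.cast_one, Nat.cast_zero, zero_mul, add_zero]
  exact Finset.sum_congr rfl fun n _ => by ring

/-- Taylor coefficients of the energy density of the self-similar profile. -/
def energyCoeff (a : ℝ) : ℕ → ℝ
  | 0 => 4 + 2 / a + a * (2 * a + 1)
  | n + 1 => energyCoeff a n * ((n + 1 + a) * (2 * n + 3 + 2 * a) / ((2 * n + 3) * (n + 2)))

theorem energyCoeff_pos {a : ℝ} (ha : 0 < a) (n : ℕ) : 0 < energyCoeff a n := by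
  induction n with
  | zero => rw [energyCoeff]; positivity
  | succ n ih => rw [energyCoeff]; positivity

theorem energyCoeff_le {a : ℝ} (ha : 0 < a) (ha2 : a < 1 / 2) (n : ℕ) :
    energyCoeff a n ≤ energyCoeff a 0 *
      exp (-((1 - 2 * a) / 2) * ∑ i ∈ Finset.range n, 1 / ((i : ℝ) + 1)) := by
  induction n with
  | zero => simp
  | succ n ih =>
    rw [Finset.sum_range_succ, mul_add, exp_add, ← mul_assoc, energyCoeff]
    refine mul_le_mul ih ?_ (by positivity) (by have := energyCoeff_pos ha 0; positivity)
    refine le_trans ?_ (add_one_le_exp _)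
    rw [div_le_iff₀ (by positivity), mul_one_div, ← sub_nonneg]
    have : (-((1 - 2 * a) / 2) / ((n : ℝ) + 1) + 1) * ((2 * n + 3) * (n + 2))
        - (n + 1 + a) * (2 * n + 3 + 2 * a)
        = (1 - 2 * a) * ((2 * n + 3) * n + 2 * a * (n + 1)) / (2 * (n + 1)) := by
      field_simp
      ring
    rw [this]
    have : 0 < 1 - 2 * a := by linarith
    positivity

theorem exists_energyCoeff_lt_one {a : ℝ} (ha : 0 < a) (ha2 : a < 1 / 2) :
    ∃ N, energyCoeff a N < 1 := by
  have h1 : Filter.Tendsto (fun n => energyCoeff a 0 *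
      exp (-((1 - 2 * a) / 2) * ∑ i ∈ Finset.range n, 1 / ((i : ℝ) + 1))) Filter.atTop
      (nhds (energyCoeff a 0 * 0)) :=
    ((tendsto_exp_atBot.comp (Real.tendsto_sum_range_one_div_nat_succ_atTop.const_mul_atTop_of_neg
      (by linarith))).const_mul _)
  rw [mul_zero] at h1
  obtain ⟨N, hN⟩ := (h1.eventually_lt_const one_pos).exists
  exact ⟨N, (energyCoeff_le ha ha2 N).trans_lt hN⟩

/-- The quadratic quantities of a self-similar profile: `V` is the potential along the profile, and
`k`, `h`, `g` are the entries of its (reduced) Gram matrix. -/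
theorem exists_profile_gram {a : ℝ} (ha : 0 < a) (ha2 : a < 1 / 2) :
    ∃ V k h g : ℝ → ℝ, ContDiff ℝ (⊤ : ℕ∞) V ∧ ContDiff ℝ (⊤ : ℕ∞) k ∧ ContDiff ℝ (⊤ : ℕ∞) h ∧
      ContDiff ℝ (⊤ : ℕ∞) g ∧
      (∀ σ ∈ Set.Icc (0 : ℝ) 1, 0 < V σ ∧ 0 < k σ ∧ h σ ^ 2 < k σ * g σ) ∧
      ∀ σ, 4 * σ * (1 - σ) * deriv h σ + (6 - (4 * a + 6) * σ) * h σ + 2 * σ * deriv k σ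
          + (2 * a + 1) * k σ = 0 ∧
        k σ - 4 * σ * h σ - 4 * σ * (1 - σ) * g σ = (2 + 2 / a) * V σ + a * (a + 1) ∧
        2 * σ * (1 - σ) * deriv g σ + (6 - (4 * a + 6) * σ) * g σ + (2 * a + 1) * h σ
          + 1 / 2 * deriv k σ = deriv V σ := by
  obtain ⟨N, hN⟩ := exists_energyCoeff_lt_one ha ha2
  set w := energyCoeff a with hw
  have hwpos : ∀ n, 0 < w n := energyCoeff_pos ha
  have hws : ∀ n : ℕ, w (n + 1)
      = w n * ((n + 1 + a) * (2 * n + 3 + 2 * a) / ((2 * n + 3) * (n + 2))) := fun n => rfl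
  set κ : ℝ := (N + 1 + a) * (2 * N + 3 + 2 * a) / (2 * N + 3) with hκ
  set v : ℝ := κ * w N / (4 + 2 / a + 4 * (N + 1)) with hv
  have hv0 : 0 < v := by have := hwpos N; positivity
  have hv1 : v < 1 := by
    have hκ2 : κ ≤ N + 2 := by
      rw [hκ, div_le_iff₀ (by positivity), ← sub_nonneg]
      have : ((N : ℝ) + 2) * (2 * N + 3) - (N + 1 + a) * (2 * N + 3 + 2 * a)
        = (1 - 2 * a) * (2 * N + 3 + a) := by ring
      rw [this]
      have : 0 < 1 - 2 * a := by linarith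
      positivity
    rw [hv, div_lt_one (by positivity)]
    have : 0 < 2 / a := by positivity
    nlinarith [hwpos N]
  set b : ℕ → ℝ := fun n => if n < N then 1 / 2 * w (n + 1) else (2 + 1 / a) * v with hb
  have hbpos : ∀ n, 0 < b n := fun n => by
    simp only [hb]
    split_ifs
    · have := hwpos (n + 1); positivity
    · positivity
  set c : ℕ → ℝ := fun n => -((n + a + 1) / (2 * n + 3) * w n) with hc
  set W : ℝ → ℝ := fun σ => ∑ n ∈ Finset.range (N + 1), w n * σ ^ n with hW
  set B : ℝ → ℝ := fun σ => ∑ n ∈ Finset.range (N + 1), b n * σ ^ n with hB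
  set C : ℝ → ℝ := fun σ => ∑ n ∈ Finset.range (N + 1), c n * σ ^ n with hC
  set V : ℝ → ℝ := fun σ => 1 - v * σ ^ (N + 1) with hV
  have dW := hasDerivAt_sum_mul_pow w N
  have dB := hasDerivAt_sum_mul_pow b N
  have dC := hasDerivAt_sum_mul_pow c N
  set W' : ℝ → ℝ := fun σ => ∑ n ∈ Finset.range N, (n + 1) * w (n + 1) * σ ^ n with hW'
  set B' : ℝ → ℝ := fun σ => ∑ n ∈ Finset.range N, (n + 1) * b (n + 1) * σ ^ n with hB'
  set C' : ℝ → ℝ := fun σ => ∑ n ∈ Finset.range N, (n + 1) * c (n + 1) * σ ^ n with hC'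
  have dV : ∀ σ, HasDerivAt V (-(v * ((N + 1) * σ ^ N))) σ := fun σ => by
    have := ((hasDerivAt_pow (N + 1) σ).const_mul v).const_sub 1
    simpa using this
  have relB : ∀ σ, σ * B σ = 1 / 2 * W σ - (2 + 1 / a) * V σ - 1 / 2 * (a * (2 * a + 1)) := by
    intro σ
    have h1 : B σ = ∑ n ∈ Finset.range N, 1 / 2 * w (n + 1) * σ ^ n
        + (2 + 1 / a) * v * σ ^ N := by
      simp only [hB]
      rw [Finset.sum_range_succ]
      congr 1
      · exact Finset.sum_congr rfl fun n hn => by simp [hb, Finset.mem_range.1 hn]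
      · simp [hb]
    have h2 : W σ = w 0 + 2 * (σ * ∑ n ∈ Finset.range N, 1 / 2 * w (n + 1) * σ ^ n) := by
      simp only [hW]
      rw [Finset.sum_range_succ', add_comm, Finset.mul_sum, Finset.mul_sum]
      congr 1
      · simp
      · exact Finset.sum_congr rfl fun n hn => by ring
    have h3 : w 0 = 4 + 2 / a + a * (2 * a + 1) := rfl
    rw [h1, h2, h3]
    simp only [hV]
    ring
  have relB' : ∀ σ, B σ + σ * B' σ = 1 / 2 * W' σ - (2 + 1 / a) * -(v * ((N + 1) * σ ^ N)) := by
    intro σ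
    have h1 := (hasDerivAt_id σ).mul (dB σ)
    have h2 := (((dW σ).const_mul (1 / 2)).sub ((dV σ).const_mul (2 + 1 / a))).sub_const
      (1 / 2 * (a * (2 * a + 1)))
    have h3 : (id * fun x => ∑ n ∈ Finset.range (N + 1), b n * x ^ n) = fun σ =>
      1 / 2 * W σ - (2 + 1 / a) * V σ - 1 / 2 * (a * (2 * a + 1)) := funext relB
    rw [h3] at h1
    simpa using h1.unique h2
  have energy : ∀ σ, 3 * C σ + 2 * (σ * C' σ) = -(a + 1) * W σ - σ * W' σ := by
    intro σ
    simp only [hC', hW', mul_sum_succ_mul_pow]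
    simp only [hC, hW, Finset.mul_sum]
    rw [← Finset.sum_add_distrib, ← Finset.sum_sub_distrib]
    refine Finset.sum_congr rfl fun n _ => ?_
    simp only [hc]
    field_simp
    ring
  have momentum : ∀ σ, -(2 * a + 3) * C σ - 2 * (σ * C' σ)
      = W' σ - 4 * -(v * ((N + 1) * σ ^ N)) + 2 * B σ := by
    intro σ
    simp only [hC', mul_sum_succ_mul_pow]
    simp only [hW', hC, hB, Finset.mul_sum]
    rw [← Finset.sum_sub_distrib, Finset.sum_range_succ, Finset.sum_range_succ _ N]
    have h1 : ∀ n ∈ Finset.range N, -(2 * a + 3) * (c n * σ ^ n) - 2 * (n * c n * σ ^ n)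
        = (n + 1) * w (n + 1) * σ ^ n + 2 * (b n * σ ^ n) := fun n hn => by
      simp only [hb, hc, Finset.mem_range.1 hn, if_true, hws]
      field_simp
      ring
    have h2 : -(2 * a + 3) * (c N * σ ^ N) - 2 * (N * c N * σ ^ N)
        = -(4 * -(v * ((N + 1) * σ ^ N))) + 2 * (b N * σ ^ N) := by
      simp only [hb, hc, lt_irrefl, if_false, hv, hκ]
      field_simp
      ring
    rw [Finset.sum_congr rfl h1, h2, Finset.sum_add_distrib]
    ring
  have cauchy : ∀ σ, 0 ≤ σ → 2 * C σ ^ 2 ≤ W σ * B σ := by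
    intro σ hσ
    have h1 : (∑ n ∈ Finset.range (N + 1), 2 * (c n * σ ^ n)) ^ 2 ≤
        (∑ n ∈ Finset.range (N + 1), w n * σ ^ n) *
        ∑ n ∈ Finset.range (N + 1), (2 * ((n + a + 1) / (2 * n + 3))) ^ 2 * w n * σ ^ n := by
      refine Finset.sum_sq_le_sum_mul_sum_of_sq_le_mul _ (fun n _ => ?_) (fun n _ => ?_)
        fun n _ => ?_
      · have := hwpos n; positivity
      · have := hwpos n; positivity
      · simp only [hc]
        exact le_of_eq (by ring)
    have h2 : ∑ n ∈ Finset.range (N + 1), (2 * ((n + a + 1) / (2 * n + 3))) ^ 2 * w n * σ ^ n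
        ≤ 2 * B σ := by
      simp only [hB]
      rw [Finset.mul_sum]
      refine Finset.sum_le_sum fun n hn => ?_
      rw [← mul_assoc]
      refine mul_le_mul_of_nonneg_right ?_ (by positivity)
      have hr : (2 * (((n : ℝ) + a + 1) / (2 * n + 3))) ^ 2
          ≤ (n + 1 + a) * (2 * n + 3 + 2 * a) / ((2 * n + 3) * (n + 2)) := by
        rw [← sub_nonneg]
        have : ((n : ℝ) + 1 + a) * (2 * n + 3 + 2 * a) / ((2 * n + 3) * (n + 2))
            - (2 * (((n : ℝ) + a + 1) / (2 * n + 3))) ^ 2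
            = (n + 1 + a) * (1 - 2 * a) / ((2 * n + 3) ^ 2 * (n + 2)) := by
          field_simp
          ring
        rw [this]
        have : 0 < 1 - 2 * a := by linarith
        positivity
      simp only [hb]
      split_ifs with hn'
      · rw [hws]
        have := mul_le_mul_of_nonneg_right hr (hwpos n).le
        linarith
      · obtain rfl : n = N := by
          have := Finset.mem_range.1 hn
          omega
        have := mul_le_mul_of_nonneg_right hr (hwpos n).le
        refine this.trans ?_
        rw [← sub_nonneg]
        have : 2 * ((2 + 1 / a) * v) - (n + 1 + a) * (2 * n + 3 + 2 * a)
            / ((2 * n + 3) * (n + 2)) * w n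
            = κ * w n * ((n + 1) / ((2 * a + 1 + 2 * a * (n + 1)) * (n + 2))) := by
          simp only [hv, hκ]
          field_simp
          ring
        rw [this]
        have := hwpos n
        positivity
    have h3 : ∑ n ∈ Finset.range (N + 1), 2 * (c n * σ ^ n) = 2 * C σ := by
      rw [← Finset.mul_sum]
    have hWn : 0 ≤ W σ := Finset.sum_nonneg fun n _ => by have := hwpos n; positivity
    rw [h3] at h1
    have := h1.trans (mul_le_mul_of_nonneg_left h2 hWn)
    linarith
  have hBpos : ∀ σ, 0 ≤ σ → 0 < B σ := fun σ hσ => by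
    refine Finset.sum_pos' (fun n _ => by have := hbpos n; positivity)
      ⟨0, by simp, by simpa using hbpos 0⟩
  have hVpos : ∀ σ ∈ Set.Icc (0 : ℝ) 1, 0 < V σ := fun σ hσ => by
    have : σ ^ (N + 1) ≤ 1 := pow_le_one₀ hσ.1 hσ.2
    simp only [hV]
    nlinarith [pow_nonneg hσ.1 (N + 1)]
  set A : ℝ → ℝ := fun σ => 1 / 2 * W σ + 1 / a * V σ + 1 / 2 * (a * (2 * a + 1)) with hA
  have dA : ∀ σ, HasDerivAt A (1 / 2 * W' σ + 1 / a * -(v * ((N + 1) * σ ^ N))) σ := fun σ =>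
    (((dW σ).const_mul (1 / 2)).add ((dV σ).const_mul (1 / a))).add_const _
  set k : ℝ → ℝ := fun σ => A σ + 2 * (σ * C σ) + σ * (σ * B σ) - a ^ 2 with hk
  set h : ℝ → ℝ := fun σ => 1 / 2 * (C σ + σ * B σ) with hh
  set g : ℝ → ℝ := fun σ => 1 / 4 * B σ with hg
  have dk : ∀ σ, deriv k σ = 1 / 2 * W' σ + 1 / a * -(v * ((N + 1) * σ ^ N))
      + 2 * (C σ + σ * C' σ) + (σ * B σ + σ * (B σ + σ * B' σ)) := fun σ => by
    have := (((dA σ).add (((hasDerivAt_id σ).mul (dC σ)).const_mul 2)).add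
      ((hasDerivAt_id σ).mul ((hasDerivAt_id σ).mul (dB σ)))).sub_const (a ^ 2)
    refine (HasDerivAt.deriv (f := k) this).trans ?_
    simp [hC, hB, hC', hB']
  have dh : ∀ σ, deriv h σ = 1 / 2 * (C' σ + (B σ + σ * B' σ)) := fun σ => by
    have := ((dC σ).add ((hasDerivAt_id σ).mul (dB σ))).const_mul (1 / 2)
    refine (HasDerivAt.deriv (f := h) this).trans ?_
    simp [hB, hC', hB']
  have dg : ∀ σ, deriv g σ = 1 / 4 * B' σ := fun σ =>
    HasDerivAt.deriv (f := g) ((dB σ).const_mul (1 / 4))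
  have cW : ContDiff ℝ (⊤ : ℕ∞) W := by fun_prop
  have cB : ContDiff ℝ (⊤ : ℕ∞) B := by fun_prop
  have cC : ContDiff ℝ (⊤ : ℕ∞) C := by fun_prop
  have cV : ContDiff ℝ (⊤ : ℕ∞) V := by fun_prop
  have cA : ContDiff ℝ (⊤ : ℕ∞) A := by fun_prop
  refine ⟨V, k, h, g, cV, by fun_prop, by fun_prop, by fun_prop, fun σ hσ => ?_, fun σ => ?_⟩
  · have h1 : h σ ^ 2 < k σ * g σ := by
      have e1 := cauchy σ hσ.1
      have e2 := hBpos σ hσ.1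
      have e3 : 0 < 1 / a * V σ + a / 2 := by have := hVpos σ hσ; positivity
      have e4 := mul_pos e3 e2
      simp only [hh, hk, hg, hA]
      nlinarith
    refine ⟨hVpos σ hσ, ?_, h1⟩
    have e2 : 0 < g σ := by have := hBpos σ hσ.1; simp only [hg]; positivity
    exact (pos_iff_pos_of_mul_pos ((sq_nonneg _).trans_lt h1)).2 e2
  · have r1 := relB σ
    have r2 := relB' σ
    have r3 := energy σ
    have r4 := momentum σ
    have haa : a * (1 / a) = 1 := mul_one_div_cancel ha.ne'
    refine ⟨?_, ?_, ?_⟩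
    · rw [dh, dk]
      simp only [hh, hk, hA]
      linear_combination r3 - σ * r4 + 2 * σ * r2 + r1 + 2 * V σ * haa
    · simp only [hh, hk, hA, hg]
      linear_combination -r1
    · rw [dg, dk, (dV σ).deriv]
      simp only [hh, hg]
      linear_combination (-1 / 2) * r4 + 1 / 2 * r2

theorem exists_contDiff_deriv_eq {f : ℝ → ℝ} (hf : ContDiff ℝ (⊤ : ℕ∞) f) :
    ∃ χ : ℝ → ℝ, ContDiff ℝ (⊤ : ℕ∞) χ ∧ ∀ x, HasDerivAt χ (f x) x := by
  have hd : ∀ x, HasDerivAt (fun x => ∫ t in (0 : ℝ)..x, f t) (f x) x := fun x =>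
    hf.continuous.integral_hasStrictDerivAt 0 x |>.hasDerivAt
  refine ⟨_, contDiff_infty_iff_deriv.2 ⟨fun x => (hd x).differentiableAt, ?_⟩, hd⟩
  rwa [show deriv (fun x => ∫ t in (0 : ℝ)..x, f t) = f from funext fun x => (hd x).deriv]

/-- A planar curve with prescribed radius and angular velocity. -/
theorem exists_polar {β γ : ℝ → ℝ} (hβ : ContDiff ℝ (⊤ : ℕ∞) β) (hγ : ContDiff ℝ (⊤ : ℕ∞) γ) :
    ∃ P Q : ℝ → ℝ, ContDiff ℝ (⊤ : ℕ∞) P ∧ ContDiff ℝ (⊤ : ℕ∞) Q ∧ ∀ x,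
      P x ^ 2 + Q x ^ 2 = β x ^ 2 ∧ P x * deriv Q x - Q x * deriv P x = β x ^ 2 * γ x ∧
      deriv P x ^ 2 + deriv Q x ^ 2 = deriv β x ^ 2 + β x ^ 2 * γ x ^ 2 := by
  obtain ⟨χ, hχ, hd⟩ := exists_contDiff_deriv_eq hγ
  refine ⟨fun x => β x * cos (χ x), fun x => β x * sin (χ x), hβ.mul (contDiff_cos.comp hχ),
    hβ.mul (contDiff_sin.comp hχ), fun x => ?_⟩
  have dβ := (hβ.differentiable (by simp) x).hasDerivAt
  rw [(dβ.fun_mul (hd x).cos).deriv, (dβ.fun_mul (hd x).sin).deriv]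
  have h := sin_sq_add_cos_sq (χ x)
  refine ⟨?_, ?_, ?_⟩
  · linear_combination β x ^ 2 * h
  · linear_combination β x ^ 2 * γ x * h
  · linear_combination (deriv β x ^ 2 + β x ^ 2 * γ x ^ 2) * h

/-- A smooth positive function agreeing with the identity on `[m, ∞)`. -/
theorem exists_pos_eq_id {m : ℝ} (hm : 0 < m) :
    ∃ φ : ℝ → ℝ, ContDiff ℝ (⊤ : ℕ∞) φ ∧ (∀ x, 0 < φ x) ∧ ∀ x, m ≤ x → φ x = x := by
  set T : ℝ → ℝ := fun x => Real.smoothTransition (2 / m * x - 1) with hT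
  have hTc : ContDiff ℝ (⊤ : ℕ∞) T := Real.smoothTransition.contDiff.comp (by fun_prop)
  refine ⟨fun x => x * T x + (1 - T x), by fun_prop, fun x => ?_, fun x hx => ?_⟩
  · have h0 : 0 ≤ T x := Real.smoothTransition.nonneg _
    have h1 : T x ≤ 1 := Real.smoothTransition.le_one _
    rcases le_or_gt x 0 with hx | hx
    · have : T x = 0 := by
        refine Real.smoothTransition.zero_of_nonpos ?_
        have : 2 / m * x ≤ 0 := mul_nonpos_of_nonneg_of_nonpos (by positivity) hx
        linarith
      simp [this]
    · rcases eq_or_lt_of_le h0 with h | h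
      · simp [← h]
      · have := mul_pos hx h
        linarith
  · have : T x = 1 := by
      refine Real.smoothTransition.one_of_one_le ?_
      have : 2 ≤ 2 / m * x := by
        rw [div_mul_eq_mul_div, le_div_iff₀ hm]
        linarith
      linarith
    simp [this]

theorem exists_pos_lt_on_Icc {f : ℝ → ℝ} (hf : Continuous f)
    (h : ∀ σ ∈ Set.Icc (0 : ℝ) 1, 0 < f σ) : ∃ m, 0 < m ∧ ∀ σ ∈ Set.Icc (0 : ℝ) 1, m < f σ := by
  obtain ⟨m, hm, hmf⟩ := isCompact_Icc.exists_forall_le' hf.continuousOn h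
  exact ⟨m / 2, by linarith, fun σ hσ => by linarith [hmf σ hσ]⟩

/-- Realise the quadratic quantities `k`, `h`, `g` by a curve on the unit sphere of `ℝ⁵`, whose last
component is `ε σ`. -/
theorem exists_sphere_curve {k h g : ℝ → ℝ} (hk : ContDiff ℝ (⊤ : ℕ∞) k)
    (hh : ContDiff ℝ (⊤ : ℕ∞) h) (hg : ContDiff ℝ (⊤ : ℕ∞) g)
    (hpos : ∀ σ ∈ Set.Icc (0 : ℝ) 1, 0 < k σ ∧ h σ ^ 2 < k σ * g σ) :
    ∃ (ε : ℝ) (P Q r s : ℝ → ℝ) (U : Set ℝ), 0 < ε ∧ ContDiff ℝ (⊤ : ℕ∞) P ∧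
      ContDiff ℝ (⊤ : ℕ∞) Q ∧ ContDiff ℝ (⊤ : ℕ∞) r ∧ ContDiff ℝ (⊤ : ℕ∞) s ∧
      (∀ σ, 0 < P σ ^ 2 + Q σ ^ 2) ∧ IsOpen U ∧ Set.Icc 0 1 ⊆ U ∧ ∀ σ ∈ U,
        P σ ^ 2 + Q σ ^ 2 = ε ^ 2 * k σ ∧
        P σ * deriv Q σ - Q σ * deriv P σ = ε * h σ ∧
        P σ ^ 2 + Q σ ^ 2 + r σ ^ 2 + s σ ^ 2 + (ε * σ) ^ 2 = 1 ∧
        deriv P σ ^ 2 + deriv Q σ ^ 2 + deriv r σ ^ 2 + deriv s σ ^ 2 + ε ^ 2 = g σ := by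
  obtain ⟨m₁, hm₁, hkm⟩ := exists_pos_lt_on_Icc hk.continuous fun σ hσ => (hpos σ hσ).1
  obtain ⟨φ₁, hφ₁, hφ₁p, hφ₁e⟩ := exists_pos_eq_id hm₁
  set K : ℝ → ℝ := fun σ => φ₁ (k σ) with hK
  have hKc : ContDiff ℝ (⊤ : ℕ∞) K := hφ₁.comp hk
  have hKp : ∀ σ, 0 < K σ := fun σ => hφ₁p _
  have hKs : ContDiff ℝ (⊤ : ℕ∞) fun σ => √(K σ) := hKc.sqrt fun σ => (hKp σ).ne'
  have hG : ContDiff ℝ (⊤ : ℕ∞) fun σ => g σ - h σ ^ 2 / K σ :=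
    hg.sub ((hh.pow 2).div hKc fun σ => (hKp σ).ne')
  obtain ⟨m₃, hm₃, hgm⟩ := exists_pos_lt_on_Icc hG.continuous fun σ hσ => by
    have := hpos σ hσ
    rw [hK]
    simp only
    rw [hφ₁e _ (hkm σ hσ).le, sub_pos, div_lt_iff₀ this.1]
    linarith
  have hKd : Continuous (deriv K) := hKc.continuous_deriv (by simp)
  have hKsd : Continuous (deriv fun σ => √(K σ)) := hKs.continuous_deriv (by simp)
  obtain ⟨M, hM⟩ := (isCompact_Icc (a := (0 : ℝ)) (b := 1)).exists_bound_of_continuousOn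
    (f := fun σ => deriv (fun σ => √(K σ)) σ ^ 2 + (deriv K σ + 2 * σ) ^ 2 + 1 + K σ + σ ^ 2)
    (((((hKsd.pow 2).add ((hKd.add (continuous_const.mul continuous_id)).pow 2)).add
      continuous_const).add hKc.continuous).add (continuous_id.pow 2)).continuousOn
  have hM1 : 1 ≤ M := by
    have h1 := (le_abs_self _).trans (hM 0 (by simp))
    have h2 := hKp 0
    nlinarith [sq_nonneg (deriv (fun σ => √(K σ)) 0), sq_nonneg (deriv K 0 + 2 * 0)]
  obtain ⟨ε, hε, hεm⟩ : ∃ ε, 0 < ε ∧ ε < min (min (1 / (2 * M)) (m₃ / (2 * M))) 1 :=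
    exists_between (by positivity)
  have hε1 : ε < 1 := hεm.trans_le (min_le_right _ _)
  have hε2 : ε * (2 * M) < 1 :=
    (lt_div_iff₀ (by positivity)).1 (hεm.trans_le ((min_le_left _ _).trans (min_le_left _ _)))
  have hε3 : ε * (2 * M) < m₃ :=
    (lt_div_iff₀ (by positivity)).1 (hεm.trans_le ((min_le_left _ _).trans (min_le_right _ _)))
  have hεε : ε ^ 2 ≤ ε := by nlinarith
  obtain ⟨φ₂, hφ₂, hφ₂p, hφ₂e⟩ := exists_pos_eq_id (m := 1 / 2) (by norm_num)
  set L : ℝ → ℝ := fun σ => 1 - ε ^ 2 * K σ - (ε * σ) ^ 2 with hL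
  have hLc : ContDiff ℝ (⊤ : ℕ∞) L := by fun_prop
  set β₂ : ℝ → ℝ := fun σ => √(φ₂ (L σ)) with hβ₂
  have hβ₂c : ContDiff ℝ (⊤ : ℕ∞) β₂ := (hφ₂.comp hLc).sqrt fun σ => (hφ₂p _).ne'
  have hβ₂p : ∀ σ, 0 < β₂ σ := fun σ => Real.sqrt_pos.2 (hφ₂p _)
  set β₁ : ℝ → ℝ := fun σ => ε * √(K σ) with hβ₁
  have hβ₁c : ContDiff ℝ (⊤ : ℕ∞) β₁ := contDiff_const.mul hKs
  have hβ₁d : ContDiff ℝ (⊤ : ℕ∞) (deriv β₁) := (contDiff_infty_iff_deriv.1 hβ₁c).2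
  have hβ₂d : ContDiff ℝ (⊤ : ℕ∞) (deriv β₂) := (contDiff_infty_iff_deriv.1 hβ₂c).2
  set D : ℝ → ℝ := fun σ => g σ - h σ ^ 2 / K σ - deriv β₁ σ ^ 2 - deriv β₂ σ ^ 2 - ε ^ 2 with hD
  have hDc : ContDiff ℝ (⊤ : ℕ∞) D :=
    ((hG.sub (hβ₁d.pow 2)).sub (hβ₂d.pow 2)).sub contDiff_const
  have hLhalf : ∀ σ ∈ Set.Icc (0 : ℝ) 1, 1 / 2 < L σ := fun σ hσ => by
    have h1 := (le_abs_self _).trans (hM σ hσ)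
    have h2 := hKp σ
    have h3 : K σ + σ ^ 2 ≤ M := by
      nlinarith [sq_nonneg (deriv (fun σ => √(K σ)) σ), sq_nonneg (deriv K σ + 2 * σ)]
    have h4 : ε ^ 2 * (K σ + σ ^ 2) ≤ ε * M :=
      mul_le_mul hεε h3 (by positivity) hε.le
    simp only [hL]
    nlinarith
  have hDpos : ∀ σ ∈ Set.Icc (0 : ℝ) 1, 0 < D σ := fun σ hσ => by
    have d1 : deriv β₁ σ = ε * deriv (fun σ => √(K σ)) σ :=
      deriv_const_mul _ (hKs.differentiable (by simp) σ)
    have d2 : deriv β₂ σ = -ε ^ 2 * (deriv K σ + 2 * σ) / (2 * √(L σ)) := by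
      have e1 : β₂ =ᶠ[nhds σ] fun σ => √(L σ) := by
        filter_upwards [hLc.continuous.continuousAt.eventually_const_lt (hLhalf σ hσ)] with x hx
        simp only [hβ₂, hφ₂e _ hx.le]
      have e2 : HasDerivAt L (-(ε ^ 2 * deriv K σ) - 2 * (ε * σ) * ε) σ := by
        have := (((hKc.differentiable (by simp) σ).hasDerivAt.const_mul (ε ^ 2)).const_sub 1).sub
          (((hasDerivAt_id σ).const_mul ε).pow 2)
        refine this.congr_deriv ?_
        simp
      rw [e1.deriv_eq, (e2.sqrt (by linarith [hLhalf σ hσ])).deriv]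
      ring
    have h1 := (le_abs_self _).trans (hM σ hσ)
    have h2 := hgm σ hσ
    have h3 := hLhalf σ hσ
    have h5 : deriv β₂ σ ^ 2 ≤ ε ^ 2 * (deriv K σ + 2 * σ) ^ 2 := by
      rw [d2, div_pow, div_le_iff₀ (by positivity), mul_pow, mul_pow, Real.sq_sqrt (by linarith)]
      have : (-ε ^ 2) ^ 2 * (deriv K σ + 2 * σ) ^ 2
          = ε ^ 2 * (deriv K σ + 2 * σ) ^ 2 * ε ^ 2 := by ring
      rw [this]
      refine mul_le_mul_of_nonneg_left ?_ (by positivity)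
      nlinarith
    have h6 : deriv (fun σ => √(K σ)) σ ^ 2 + (deriv K σ + 2 * σ) ^ 2 + 1 ≤ M := by
      nlinarith [hKp σ, sq_nonneg σ]
    have h7 : ε ^ 2 * (deriv (fun σ => √(K σ)) σ ^ 2 + (deriv K σ + 2 * σ) ^ 2 + 1) ≤ ε * M :=
      mul_le_mul hεε h6 (by positivity) hε.le
    simp only [hD]
    rw [d1, mul_pow]
    nlinarith
  obtain ⟨m₄, hm₄, hDm⟩ := exists_pos_lt_on_Icc hDc.continuous hDpos
  obtain ⟨φ₃, hφ₃, hφ₃p, hφ₃e⟩ := exists_pos_eq_id hm₄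
  obtain ⟨P, Q, hP, hQ, hPQ⟩ := exists_polar hβ₁c (γ := fun σ => h σ / (ε * K σ))
    (hh.div (contDiff_const.mul hKc) fun σ => (mul_pos hε (hKp σ)).ne')
  obtain ⟨r, s, hr, hs, hrs⟩ := exists_polar hβ₂c (γ := fun σ => √(φ₃ (D σ)) / β₂ σ)
    (((hφ₃.comp hDc).sqrt fun σ => (hφ₃p _).ne').div hβ₂c fun σ => (hβ₂p σ).ne')
  have hβ₁s : ∀ σ, β₁ σ ^ 2 = ε ^ 2 * K σ := fun σ => by
    simp only [hβ₁, mul_pow, Real.sq_sqrt (hKp σ).le]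
  refine ⟨ε, P, Q, r, s, {σ | m₁ < k σ} ∩ {σ | 1 / 2 < L σ} ∩ {σ | m₄ < D σ}, hε, hP, hQ, hr, hs,
    fun σ => ?_, ?_, fun σ hσ => ⟨⟨hkm σ hσ, hLhalf σ hσ⟩, hDm σ hσ⟩, ?_⟩
  · rw [(hPQ σ).1, hβ₁s]
    have := hKp σ
    positivity
  · exact ((isOpen_lt continuous_const hk.continuous).inter
      (isOpen_lt continuous_const hLc.continuous)).inter
      (isOpen_lt continuous_const hDc.continuous)
  · rintro σ ⟨⟨h1, h2⟩, h3⟩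
    simp only [Set.mem_ofPred_eq] at h1 h2 h3
    obtain ⟨p1, p2, p3⟩ := hPQ σ
    obtain ⟨q1, q2, q3⟩ := hrs σ
    have hKk : K σ = k σ := hφ₁e _ h1.le
    have hβ₂s : β₂ σ ^ 2 = L σ := by
      simp only [hβ₂]
      rw [Real.sq_sqrt (hφ₂p _).le, hφ₂e _ h2.le]
    have e1 : β₁ σ ^ 2 * (h σ / (ε * K σ)) = ε * h σ := by
      rw [hβ₁s]
      have := hKp σ
      field_simp
    have e2 : β₁ σ ^ 2 * (h σ / (ε * K σ)) ^ 2 = h σ ^ 2 / K σ := by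
      rw [hβ₁s]
      have := hKp σ
      field_simp
    have e3 : β₂ σ ^ 2 * (√(φ₃ (D σ)) / β₂ σ) ^ 2 = D σ := by
      rw [div_pow, mul_div_cancel₀ _ (pow_pos (hβ₂p σ) 2).ne', Real.sq_sqrt (hφ₃p _).le,
        hφ₃e _ h3.le]
    rw [e1] at p2
    rw [e2] at p3
    rw [e3] at q3
    rw [hβ₁s] at p1
    rw [hβ₂s] at q1
    refine ⟨by rw [p1, hKk], p2, ?_, ?_⟩
    · simp only [hL] at q1
      linarith
    · simp only [hD] at q3
      linarith

/-- The action of the d'Alembertian on self-similar functions `(1 - t)^(-a) f(|x|² / (1 - t)²)`. -/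
def profileOp (a : ℝ) (f : ℝ → ℝ) (σ : ℝ) : ℝ :=
  4 * σ * (1 - σ) * deriv (deriv f) σ + (6 - (4 * a + 6) * σ) * deriv f σ - a * (a + 1) * f σ

/-- The first component of the action of the d'Alembertian on self-similar planar curves
`(f, g)` rotated by the angle `ω log (1 - t)`. -/
def rotProfileOp (a ω : ℝ) (f g : ℝ → ℝ) (σ : ℝ) : ℝ :=
  profileOp a f σ + ω ^ 2 * f σ - ω * (4 * σ * deriv g σ + (2 * a + 1) * g σ)

theorem profileOp_const_mul (a ε σ : ℝ) :
    profileOp a (fun x => ε * x) σ = (6 - (4 * a + 6) * σ) * ε - a * (a + 1) * (ε * σ) := by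
  have h : deriv (fun x : ℝ => ε * x) = fun _ => ε := by
    funext x
    rw [deriv_const_mul _ differentiableAt_fun_id]
    simp
  simp [profileOp, h]

theorem exists_profile {a : ℝ} (ha : 0 < a) (ha2 : a < 1 / 2) :
    ∃ (ε ω : ℝ) (V P Q r s : ℝ → ℝ), 0 < ε ∧ ContDiff ℝ (⊤ : ℕ∞) V ∧ ContDiff ℝ (⊤ : ℕ∞) P ∧
      ContDiff ℝ (⊤ : ℕ∞) Q ∧ ContDiff ℝ (⊤ : ℕ∞) r ∧ ContDiff ℝ (⊤ : ℕ∞) s ∧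
      (∀ σ, 0 < V σ) ∧ (∀ σ, 0 < P σ ^ 2 + Q σ ^ 2) ∧ ∀ σ ∈ Set.Icc (0 : ℝ) 1,
        P σ ^ 2 + Q σ ^ 2 + r σ ^ 2 + s σ ^ 2 + (ε * σ) ^ 2 = 1 ∧
        P σ * rotProfileOp a (-ω) Q P σ - Q σ * rotProfileOp a ω P Q σ = 0 ∧
        P σ * rotProfileOp a ω P Q σ + Q σ * rotProfileOp a (-ω) Q P σ + r σ * profileOp a r σ
          + s σ * profileOp a s σ + ε * σ * profileOp a (fun x => ε * x) σ
          = (2 + 2 / a) * V σ ∧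
        deriv P σ * rotProfileOp a ω P Q σ + deriv Q σ * rotProfileOp a (-ω) Q P σ
          + deriv r σ * profileOp a r σ + deriv s σ * profileOp a s σ
          + ε * profileOp a (fun x => ε * x) σ = deriv V σ := by
  obtain ⟨V, k, h, g, hV, hk, hh, hg, hpos, hid⟩ := exists_profile_gram ha ha2
  obtain ⟨ε, P, Q, r, s, U, hε, hP, hQ, hr, hs, hPQ, hU, hIU, hX⟩ :=
    exists_sphere_curve hk hh hg fun σ hσ => (hpos σ hσ).2
  obtain ⟨m, hm, hVm⟩ := exists_pos_lt_on_Icc hV.continuous fun σ hσ => (hpos σ hσ).1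
  obtain ⟨φ, hφ, hφp, hφe⟩ := exists_pos_eq_id hm
  refine ⟨ε, ε⁻¹, fun σ => φ (V σ), P, Q, r, s, hε, hφ.comp hV, hP, hQ, hr, hs, fun σ => hφp _,
    hPQ, fun σ hσ => ?_⟩
  have hσU := hU.mem_nhds (hIU hσ)
  have eV : (fun σ => φ (V σ)) =ᶠ[nhds σ] V := by
    filter_upwards [hV.continuous.continuousAt.eventually_const_lt (hVm σ hσ)] with x hx
    exact hφe _ hx.le
  have eV0 : φ (V σ) = V σ := eV.eq_of_nhds
  rw [eV.deriv_eq]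
  beta_reduce
  rw [eV0]
  have hd : ∀ {f : ℝ → ℝ}, ContDiff ℝ (⊤ : ℕ∞) f → ∀ x, HasDerivAt f (deriv f x) x :=
    fun hf x => (hf.differentiable (by simp) x).hasDerivAt
  have hd2 : ∀ {f : ℝ → ℝ}, ContDiff ℝ (⊤ : ℕ∞) f →
      ∀ x, HasDerivAt (deriv f) (deriv (deriv f) x) x :=
    fun hf => hd (contDiff_infty_iff_deriv.1 hf).2
  have hlin : ∀ x : ℝ, HasDerivAt (fun σ => ε * σ) ε x := fun x => by
    simpa using (hasDerivAt_id x).const_mul ε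
  have g1 : ∀ x ∈ U, 2 * (P x * deriv P x + Q x * deriv Q x) = ε ^ 2 * deriv k x := fun x hx => by
    have e : (fun x => P x ^ 2 + Q x ^ 2) =ᶠ[nhds x] fun x => ε ^ 2 * k x := by
      filter_upwards [hU.mem_nhds hx] with y hy using (hX y hy).1
    have := ((((hd hP x).fun_pow 2).fun_add ((hd hQ x).fun_pow 2)).congr_of_eventuallyEq
      e.symm).unique ((hd hk x).const_mul (ε ^ 2))
    norm_num at this
    linarith
  have g2 : P σ * deriv (deriv Q) σ - Q σ * deriv (deriv P) σ = ε * deriv h σ := by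
    have e : (fun x => P x * deriv Q x - Q x * deriv P x) =ᶠ[nhds σ] fun x => ε * h x := by
      filter_upwards [hσU] with y hy using (hX y hy).2.1
    have := ((((hd hP σ).fun_mul (hd2 hQ σ)).fun_sub
      ((hd hQ σ).fun_mul (hd2 hP σ))).congr_of_eventuallyEq e.symm).unique ((hd hh σ).const_mul ε)
    linarith
  have g3 : ∀ x ∈ U, P x * deriv P x + Q x * deriv Q x + r x * deriv r x + s x * deriv s x
      + ε * x * ε = 0 := fun x hx => by
    have e : (fun x => P x ^ 2 + Q x ^ 2 + r x ^ 2 + s x ^ 2 + (ε * x) ^ 2) =ᶠ[nhds x]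
        fun _ => 1 := by
      filter_upwards [hU.mem_nhds hx] with y hy using (hX y hy).2.2.1
    have := (((((((hd hP x).fun_pow 2).fun_add ((hd hQ x).fun_pow 2)).fun_add
      ((hd hr x).fun_pow 2)).fun_add ((hd hs x).fun_pow 2)).fun_add
      ((hlin x).fun_pow 2)).congr_of_eventuallyEq e.symm).unique (hasDerivAt_const x 1)
    norm_num at this
    linarith
  have g4 : P σ * deriv (deriv P) σ + Q σ * deriv (deriv Q) σ + r σ * deriv (deriv r) σ
      + s σ * deriv (deriv s) σ + g σ = 0 := by
    have e : (fun x => P x * deriv P x + Q x * deriv Q x + r x * deriv r x + s x * deriv s x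
        + ε * x * ε) =ᶠ[nhds σ] fun _ => 0 := by
      filter_upwards [hσU] with y hy using g3 y hy
    have := (((((((hd hP σ).fun_mul (hd2 hP σ)).fun_add ((hd hQ σ).fun_mul (hd2 hQ σ))).fun_add
      ((hd hr σ).fun_mul (hd2 hr σ))).fun_add ((hd hs σ).fun_mul (hd2 hs σ))).fun_add
      ((hlin σ).mul_const ε)).congr_of_eventuallyEq e.symm).unique (hasDerivAt_const σ 0)
    have h4 := (hX σ (hIU hσ)).2.2.2
    linarith
  have g5 : 2 * (deriv P σ * deriv (deriv P) σ + deriv Q σ * deriv (deriv Q) σ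
      + deriv r σ * deriv (deriv r) σ + deriv s σ * deriv (deriv s) σ) = deriv g σ := by
    have e : (fun x => deriv P x ^ 2 + deriv Q x ^ 2 + deriv r x ^ 2 + deriv s x ^ 2
        + ε ^ 2) =ᶠ[nhds σ] g := by
      filter_upwards [hσU] with y hy using (hX y hy).2.2.2
    have := (((((((hd2 hP σ).fun_pow 2).fun_add ((hd2 hQ σ).fun_pow 2)).fun_add
      ((hd2 hr σ).fun_pow 2)).fun_add ((hd2 hs σ).fun_pow 2)).add_const
      (ε ^ 2)).congr_of_eventuallyEq e.symm).unique (hd hg σ)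
    norm_num at this
    linarith
  obtain ⟨x1, x2, x3, x4⟩ := hX σ (hIU hσ)
  have y1 := g1 σ (hIU hσ)
  have y3 := g3 σ (hIU hσ)
  obtain ⟨i1, i2, i3⟩ := hid σ
  have hεε : ε * ε⁻¹ = 1 := mul_inv_cancel₀ hε.ne'
  set ω := ε⁻¹ with hω
  clear_value ω
  simp only [rotProfileOp, profileOp_const_mul]
  simp only [profileOp]
  refine ⟨x3, ?_, ?_, ?_⟩
  · linear_combination 4 * σ * (1 - σ) * g2 + (6 - (4 * a + 6) * σ) * x2 + 2 * σ * ω * y1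
      + (2 * a + 1) * ω * x1 + ε * i1 + (2 * σ * deriv k σ + (2 * a + 1) * k σ) * ε * hεε
  · linear_combination 4 * σ * (1 - σ) * g4 + (6 - (4 * a + 6) * σ) * y3 - a * (a + 1) * x3
      + ω ^ 2 * x1 - 4 * σ * ω * x2 + i2 + (k σ * (ε * ω + 1) - 4 * σ * h σ) * hεε
  · linear_combination 2 * σ * (1 - σ) * g5 + (6 - (4 * a + 6) * σ) * x4 - a * (a + 1) * y3
      + ω ^ 2 / 2 * y1 + (2 * a + 1) * ω * x2 + i3
      + (deriv k σ / 2 * (ε * ω + 1) + (2 * a + 1) * h σ) * hεε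

theorem pd_coord_self {d : ℕ} (y : Sp d) (α : Fin (d + 1)) :
    pd α (fun z : Sp d => z α) y = 1 := by
  unfold pd
  have : HasFDerivAt (fun z : Sp d => z α) (ContinuousLinearMap.proj (R := ℝ) α) y :=
    (ContinuousLinearMap.proj (R := ℝ) (φ := fun _ : Fin (d + 1) => ℝ) α).hasFDerivAt
  rw [this.fderiv]
  simp

/-- The self-similar function `A(t) b(|x|² / s²)`, where `s = exp ℓ(t)`. -/
def selfSimilar {d : ℕ} (ℓ A b : ℝ → ℝ) (y : Sp d) : ℝ :=
  A (y 0) * b (radSq y * exp (-2 * ℓ (y 0)))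

section

variable {d : ℕ} {ℓ A B b : ℝ → ℝ}

theorem selfSimilar_contDiff (hℓ : ContDiff ℝ (⊤ : ℕ∞) ℓ) (hA : ContDiff ℝ (⊤ : ℕ∞) A)
    (hb : ContDiff ℝ (⊤ : ℕ∞) b) : ContDiff ℝ (⊤ : ℕ∞) (selfSimilar (d := d) ℓ A b) := by
  have h := radSq_contDiff (d := d)
  unfold selfSimilar
  fun_prop

theorem pd_selfSimilar (hℓ : ContDiff ℝ (⊤ : ℕ∞) ℓ) (hA : ContDiff ℝ (⊤ : ℕ∞) A)
    (hb : ContDiff ℝ (⊤ : ℕ∞) b) (α : Fin (d + 1)) (y : Sp d) :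
    pd α (selfSimilar ℓ A b) y =
      deriv A (y 0) * pd α (fun z : Sp d => z 0) y * b (radSq y * exp (-2 * ℓ (y 0)))
      + A (y 0) * (deriv b (radSq y * exp (-2 * ℓ (y 0))) * (pd α radSq y * exp (-2 * ℓ (y 0))
        + radSq y * (-2 * deriv ℓ (y 0) * exp (-2 * ℓ (y 0)) * pd α (fun z : Sp d => z 0) y))) := by
  have h := radSq_contDiff (d := d)
  have hn : ((⊤ : ℕ∞) : WithTop ℕ∞) ≠ 0 := by simp
  have h0 : DifferentiableAt ℝ (fun z : Sp d => z 0) y := by fun_prop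
  have hE : ContDiff ℝ (⊤ : ℕ∞) fun t => exp (-2 * ℓ t) := by fun_prop
  have hdE : deriv (fun t => exp (-2 * ℓ t)) (y 0) = -2 * deriv ℓ (y 0) * exp (-2 * ℓ (y 0)) := by
    rw [(((hℓ.differentiable hn (y 0)).hasDerivAt.const_mul (-2)).exp).deriv]
    ring
  have e1 := pd_comp α (hA.differentiable hn (y 0)) h0
  have e2 := pd_comp α (hE.differentiable hn (y 0)) h0
  have d2 : DifferentiableAt ℝ (fun z : Sp d => exp (-2 * ℓ (z 0))) y :=
    (show ContDiff ℝ (⊤ : ℕ∞) fun z : Sp d => exp (-2 * ℓ (z 0)) by fun_prop).differentiable hn y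
  have e3 := pd_mul α (h.differentiable hn y) d2
  have e4 := pd_comp α (hb.differentiable hn _) ((h.differentiable hn y).fun_mul d2)
  have e5 := pd_mul α
    ((show ContDiff ℝ (⊤ : ℕ∞) fun z : Sp d => A (z 0) by fun_prop).differentiable hn y)
    ((show ContDiff ℝ (⊤ : ℕ∞) fun z : Sp d => b (radSq z * exp (-2 * ℓ (z 0))) by
      fun_prop).differentiable hn y)
  rw [hdE] at e2
  unfold selfSimilar
  rw [e5, e4, e3, e2, e1]

theorem pd_zero_selfSimilar (hℓ : ContDiff ℝ (⊤ : ℕ∞) ℓ) (hA : ContDiff ℝ (⊤ : ℕ∞) A)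
    (hb : ContDiff ℝ (⊤ : ℕ∞) b) (hAB : ∀ t, deriv A t = deriv ℓ t * B t) :
    pd 0 (selfSimilar (d := d) ℓ A b) = fun y =>
      deriv ℓ (y 0) * (selfSimilar ℓ B b y - 2 * selfSimilar ℓ A (fun x => x * deriv b x) y) := by
  funext y
  rw [pd_selfSimilar hℓ hA hb, pd_zero_coord, pd_radSq, hAB]
  simp only [if_pos, selfSimilar]
  ring

theorem pd_succ_selfSimilar (hℓ : ContDiff ℝ (⊤ : ℕ∞) ℓ) (hA : ContDiff ℝ (⊤ : ℕ∞) A)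
    (hb : ContDiff ℝ (⊤ : ℕ∞) b) (i : Fin d) :
    pd i.succ (selfSimilar ℓ A b) = fun y =>
      2 * y i.succ * selfSimilar ℓ (fun t => A t * exp (-2 * ℓ t)) (deriv b) y := by
  funext y
  rw [pd_selfSimilar hℓ hA hb, pd_zero_coord, pd_radSq]
  simp only [Fin.succ_ne_zero, if_false, selfSimilar]
  ring

theorem dAlembert_selfSimilar {B' : ℝ → ℝ} (hℓ : ContDiff ℝ (⊤ : ℕ∞) ℓ)
    (hA : ContDiff ℝ (⊤ : ℕ∞) A) (hB : ContDiff ℝ (⊤ : ℕ∞) B) (hb : ContDiff ℝ (⊤ : ℕ∞) b)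
    (hAB : ∀ t, deriv A t = deriv ℓ t * B t) (hBB : ∀ t, deriv B t = deriv ℓ t * B' t)
    {y : Sp d} (h1 : deriv ℓ (y 0) = -exp (-ℓ (y 0)))
    (h2 : deriv (deriv ℓ) (y 0) = -exp (-2 * ℓ (y 0))) {σ : ℝ}
    (hσ : radSq y * exp (-2 * ℓ (y 0)) = σ) :
    dAlembert (selfSimilar ℓ A b) y = exp (-2 * ℓ (y 0)) *
      (A (y 0) * (4 * σ * (1 - σ) * deriv (deriv b) σ + (2 * d - 6 * σ) * deriv b σ)
        + B (y 0) * (b σ + 4 * σ * deriv b σ) - B' (y 0) * b σ) := by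
  have hn : ((⊤ : ℕ∞) : WithTop ℕ∞) ≠ 0 := by simp
  have hb' : ContDiff ℝ (⊤ : ℕ∞) (deriv b) := (contDiff_infty_iff_deriv.1 hb).2
  have hℓ' : ContDiff ℝ (⊤ : ℕ∞) (deriv ℓ) := (contDiff_infty_iff_deriv.1 hℓ).2
  have hxb : ContDiff ℝ (⊤ : ℕ∞) fun x => x * deriv b x := contDiff_id.mul hb'
  have dxb : deriv (fun x => x * deriv b x) σ = deriv b σ + σ * deriv (deriv b) σ := by
    rw [((hasDerivAt_id' σ).fun_mul (hb'.differentiable hn σ).hasDerivAt).deriv]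
    ring
  have t1 : pd 0 (pd 0 (selfSimilar ℓ A b)) y = deriv (deriv ℓ) (y 0) * (selfSimilar ℓ B b y
      - 2 * selfSimilar ℓ A (fun x => x * deriv b x) y) + deriv ℓ (y 0) ^ 2 *
      (selfSimilar ℓ B' b y - 4 * selfSimilar ℓ B (fun x => x * deriv b x) y
        + 4 * selfSimilar ℓ A (fun x => x * deriv (fun x => x * deriv b x) x) y) := by
    have s1 := (selfSimilar_contDiff (d := d) hℓ hB hb).differentiable hn y
    have s2 := (selfSimilar_contDiff (d := d) hℓ hA hxb).differentiable hn y
    rw [pd_zero_selfSimilar hℓ hA hb hAB, pd_mul 0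
      ((show ContDiff ℝ (⊤ : ℕ∞) fun z : Sp d => deriv ℓ (z 0) by fun_prop).differentiable hn y)
      (s1.fun_sub (s2.const_mul 2)), pd_sub 0 s1 (s2.const_mul 2),
      pd_mul 0 (differentiableAt_const 2) s2,
      pd_comp 0 (hℓ'.differentiable hn _) (by fun_prop), pd_zero_coord,
      pd_zero_selfSimilar hℓ hB hb hBB, pd_zero_selfSimilar hℓ hA hxb hAB]
    simp only [if_pos, pd, fderiv_fun_const]
    simp
    ring
  have t2 : ∀ i : Fin d, pd i.succ (pd i.succ (selfSimilar ℓ A b)) y =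
      2 * selfSimilar ℓ (fun t => A t * exp (-2 * ℓ t)) (deriv b) y + 4 * y i.succ ^ 2 *
        selfSimilar ℓ (fun t => A t * exp (-2 * ℓ t) * exp (-2 * ℓ t)) (deriv (deriv b)) y := by
    intro i
    have hAE : ContDiff ℝ (⊤ : ℕ∞) fun t => A t * exp (-2 * ℓ t) := by fun_prop
    rw [pd_succ_selfSimilar hℓ hA hb, pd_mul _ (by fun_prop)
      ((selfSimilar_contDiff hℓ hAE hb').differentiable hn y),
      pd_mul _ (by fun_prop) (by fun_prop), pd_coord_self, pd_succ_selfSimilar hℓ hAE hb']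
    simp only [pd, fderiv_fun_const]
    simp
    ring
  have e2 : exp (-ℓ (y 0)) ^ 2 = exp (-2 * ℓ (y 0)) := by
    rw [← exp_nat_mul]
    push_cast
    ring_nf
  simp only [dAlembert, t1, t2, Finset.sum_add_distrib, ← Finset.sum_mul, ← Finset.mul_sum, h1, h2,
    neg_sq, e2]
  rw [← radSq]
  simp only [selfSimilar, hσ, dxb, Finset.sum_const, Finset.card_univ, Fintype.card_fin,
    nsmul_eq_mul]
  rw [← hσ]
  ring

end

section

variable {E : Type*} [NormedAddCommGroup E] [InnerProductSpace ℝ E]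

theorem hasFDerivAt_norm_smul {ρ : ℝ} (hρ : 0 < ρ) {y : E} (hy : ‖y‖ = 1) :
    HasFDerivAt (fun v : E => ‖v‖) (innerSL ℝ y) (ρ • y) := by
  have hn : ‖ρ • y‖ = ρ := by rw [norm_smul, hy, mul_one, Real.norm_of_nonneg hρ.le]
  have hne : ρ • y ≠ 0 := norm_pos_iff.1 (by rwa [hn])
  have h := ((hasStrictFDerivAt_norm_sq (ρ • y)).hasFDerivAt).sqrt
    (by rw [hn]; positivity)
  simp only [Real.sqrt_sq (norm_nonneg _), hn] at h
  refine h.congr_fderiv ?_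
  ext w
  simp [Real.sqrt_sq hρ.le]
  field_simp

/-- A homogeneous function of order `q` with prescribed angular part `exp H`. -/
def homogeneousExp (q : ℝ) (H : E → ℝ) (v : E) : ℝ := ‖v‖ ^ q * exp (H (‖v‖⁻¹ • v))

theorem homogeneousExp_pos (q : ℝ) (H : E → ℝ) {v : E} (hv : v ≠ 0) :
    0 < homogeneousExp q H v :=
  mul_pos (rpow_pos_of_pos (norm_pos_iff.2 hv) q) (exp_pos _)

theorem homogeneousExp_smul (q : ℝ) (H : E → ℝ) {l : ℝ} (hl : 0 < l) (v : E) :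
    homogeneousExp q H (l • v) = l ^ q * homogeneousExp q H v := by
  have : (l * ‖v‖)⁻¹ * l = ‖v‖⁻¹ := by field_simp
  rw [homogeneousExp, homogeneousExp, norm_smul, Real.norm_of_nonneg hl.le, smul_smul, this,
    mul_rpow hl.le (norm_nonneg v), mul_assoc]

theorem homogeneousExp_contDiffAt (q : ℝ) {H : E → ℝ} (hH : ContDiff ℝ (⊤ : ℕ∞) H) {v : E}
    (hv : v ≠ 0) : ContDiffAt ℝ (⊤ : ℕ∞) (homogeneousExp q H) v := by
  have hn := contDiffAt_norm ℝ (n := (⊤ : ℕ∞)) hv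
  have h0 : ‖v‖ ≠ 0 := norm_ne_zero_iff.2 hv
  unfold homogeneousExp
  exact (hn.rpow_const_of_ne h0).mul
    (hH.contDiffAt.comp v ((hn.inv h0).smul contDiffAt_id)).exp

theorem homogeneousExp_hasFDerivAt (q : ℝ) {H : E → ℝ} {ρ V : ℝ} {y N : E} (hρ : 0 < ρ)
    (hy : ‖y‖ = 1) (hV : exp (H y) = V) (hD : HasFDerivAt H (V⁻¹ • innerSL ℝ N) y)
    (hN : ⟪N, y⟫ = q * V) :
    HasFDerivAt (homogeneousExp q H) (ρ ^ (q - 1) • innerSL ℝ N) (ρ • y) := by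
  have hV0 : V ≠ 0 := hV ▸ (exp_pos _).ne'
  have hn : ‖ρ • y‖ = ρ := by rw [norm_smul, hy, mul_one, Real.norm_of_nonneg hρ.le]
  have hd := hasFDerivAt_norm_smul hρ hy
  have hne : ‖ρ • y‖ ≠ 0 := by rw [hn]; exact hρ.ne'
  have hy' : ‖ρ • y‖⁻¹ • ρ • y = y := by rw [hn, smul_smul, inv_mul_cancel₀ hρ.ne', one_smul]
  have h1 : HasFDerivAt (fun v : E => ‖v‖⁻¹ • v) _ (ρ • y) :=
    ((hasDerivAt_inv hne).comp_hasFDerivAt _ hd).fun_smul (hasFDerivAt_id (ρ • y))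
  have h2 : HasFDerivAt (fun v : E => exp (H (‖v‖⁻¹ • v))) _ (ρ • y) :=
    (HasFDerivAt.comp _ (hy'.symm ▸ hD) h1).exp
  have h3 := (hd.rpow_const (p := q) (Or.inl hne)).fun_mul h2
  refine h3.congr_fderiv ?_
  ext w
  have hq : ρ ^ q = ρ ^ (q - 1) * ρ := by rw [rpow_sub_one hρ.ne']; field_simp
  simp [hn, inner_smul_right, hN, hq, smul_smul, inv_mul_cancel₀ hρ.ne', hV]
  field_simp
  ring

theorem exists_homogeneous_potential [CompleteSpace E] (q : ℝ) {H : E → ℝ}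
    (hH : ContDiff ℝ (⊤ : ℕ∞) H) :
    ∃ F : E → ℝ, ContDiff ℝ (⊤ : ℕ∞) F ∧ (∀ v, 0 < F v) ∧
      (∀ l : ℝ, 1 ≤ l → ∀ v, 1 ≤ ‖v‖ → F (l • v) = l ^ q * F v) ∧
      ∀ (ρ V : ℝ) (y N : E), 1 ≤ ρ → ‖y‖ = 1 → exp (H y) = V →
        HasFDerivAt H (V⁻¹ • innerSL ℝ N) y → ⟪N, y⟫ = q * V →
        gradient F (ρ • y) = ρ ^ (q - 1) • N := by
  set η : E → ℝ := fun v => Real.smoothTransition (4 * ‖v‖ ^ 2 - 1) with hη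
  have hηc : ContDiff ℝ (⊤ : ℕ∞) η :=
    Real.smoothTransition.contDiff.comp (((contDiff_norm_sq ℝ).const_smul (4 : ℝ)).sub contDiff_const)
  have hη1 : ∀ v, 1 / 2 ≤ ‖v‖ ^ 2 → η v = 1 := fun v hv =>
    Real.smoothTransition.one_of_one_le (by linarith)
  set F : E → ℝ := fun v => η v * homogeneousExp q H v + (1 - η v) with hF
  have hF1 : ∀ v, 1 / 2 ≤ ‖v‖ ^ 2 → F v = homogeneousExp q H v := fun v hv => by
    simp [hF, hη1 v hv]
  refine ⟨F, contDiff_iff_contDiffAt.2 fun v => ?_, fun v => ?_, fun l hl v hv => ?_,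
    fun ρ V y N hρ hy hV hD hN => ?_⟩
  · rcases eq_or_ne v 0 with rfl | hv
    · have : F =ᶠ[nhds 0] fun _ => 1 := by
        filter_upwards [(continuous_norm.pow 2).continuousAt.eventually_lt_const
          (show ‖(0 : E)‖ ^ 2 < 1 / 4 by norm_num)] with w hw
        have hw : ‖w‖ ^ 2 < 1 / 4 := hw
        have : η w = 0 := Real.smoothTransition.zero_of_nonpos (by linarith)
        simp [hF, this]
      exact contDiffAt_const.congr_of_eventuallyEq this
    · exact (hηc.contDiffAt.mul (homogeneousExp_contDiffAt q hH hv)).add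
        (contDiffAt_const.sub hηc.contDiffAt)
  · have h0 : 0 ≤ η v := Real.smoothTransition.nonneg _
    have h1 : η v ≤ 1 := Real.smoothTransition.le_one _
    rcases eq_or_ne v 0 with rfl | hv
    · have : η 0 = 0 := Real.smoothTransition.zero_of_nonpos (by norm_num)
      simp [hF, this]
    · have := homogeneousExp_pos q H hv
      rcases h0.eq_or_lt with h | h
      · simp [hF, ← h]
      · exact add_pos_of_pos_of_nonneg (mul_pos h this) (by linarith)
  · have h1 : 1 ≤ ‖l • v‖ := by
      rw [norm_smul, Real.norm_of_nonneg (by linarith)]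
      exact one_le_mul_of_one_le_of_one_le hl hv
    rw [hF1 _ (by nlinarith), hF1 _ (by nlinarith), homogeneousExp_smul q H (by linarith)]
  · have hn : ‖ρ • y‖ = ρ := by
      rw [norm_smul, hy, mul_one, Real.norm_of_nonneg (by linarith)]
    have hev : F =ᶠ[nhds (ρ • y)] homogeneousExp q H := by
      filter_upwards [(continuous_norm.pow 2).continuousAt.eventually_const_lt
        (show 1 / 2 < ‖ρ • y‖ ^ 2 by rw [hn]; nlinarith)] with w hw
      exact hF1 w hw.le
    have hG : HasGradientAt F (ρ ^ (q - 1) • N) (ρ • y) := by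
      rw [hasGradientAt_iff_hasFDerivAt]
      refine ((homogeneousExp_hasFDerivAt q (by linarith) hy hV hD hN).congr_of_eventuallyEq
        hev).congr_fderiv ?_
      ext w
      simp
    exact hG.gradient

end

/-- A potential on the sphere with prescribed values and gradients along a family of circles, given
in a frame `e` by `x₀² + x₁² = k σ`, `x₂ = r σ`, `x₃ = s σ`, `x₄ = ε σ`. -/
theorem exists_angular_potential {E : Type*} [NormedAddCommGroup E] [InnerProductSpace ℝ E]
    (e : Fin 5 → E) {ε : ℝ} (hε : ε ≠ 0) {V k r s g₁ g₂ g₃ : ℝ → ℝ}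
    (hV : ContDiff ℝ (⊤ : ℕ∞) V) (hk : ContDiff ℝ (⊤ : ℕ∞) k) (hr : ContDiff ℝ (⊤ : ℕ∞) r)
    (hs : ContDiff ℝ (⊤ : ℕ∞) s) (h₁ : ContDiff ℝ (⊤ : ℕ∞) g₁) (h₂ : ContDiff ℝ (⊤ : ℕ∞) g₂)
    (h₃ : ContDiff ℝ (⊤ : ℕ∞) g₃) (hVp : ∀ σ, 0 < V σ) :
    ∃ H : E → ℝ, ContDiff ℝ (⊤ : ℕ∞) H ∧ ∀ (σ : ℝ) (y N : E),
      ⟪e 0, y⟫ ^ 2 + ⟪e 1, y⟫ ^ 2 = k σ → ⟪e 2, y⟫ = r σ → ⟪e 3, y⟫ = s σ → ⟪e 4, y⟫ = ε * σ →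
      (∀ w, ⟪N, w⟫ = g₁ σ * (⟪e 0, y⟫ * ⟪e 0, w⟫ + ⟪e 1, y⟫ * ⟪e 1, w⟫) + g₂ σ * ⟪e 2, w⟫
        + g₃ σ * ⟪e 3, w⟫ + (deriv V σ - g₁ σ * deriv k σ / 2 - g₂ σ * deriv r σ
          - g₃ σ * deriv s σ) / ε * ⟪e 4, w⟫) →
      exp (H y) = V σ ∧ HasFDerivAt H ((V σ)⁻¹ • innerSL ℝ N) y := by
  have hn : ((⊤ : ℕ∞) : WithTop ℕ∞) ≠ 0 := by simp
  have hV0 : ∀ σ, V σ ≠ 0 := fun σ => (hVp σ).ne'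
  set x : Fin 5 → E → ℝ := fun i v => ⟪e i, v⟫ with hx
  set R : E → ℝ := fun v => ε⁻¹ * x 4 v with hR
  set G₁ : ℝ → ℝ := fun σ => g₁ σ / V σ with hG₁
  set G₂ : ℝ → ℝ := fun σ => g₂ σ / V σ with hG₂
  set G₃ : ℝ → ℝ := fun σ => g₃ σ / V σ with hG₃
  have hxc : ∀ i, ContDiff ℝ (⊤ : ℕ∞) (x i) := fun i => (innerSL ℝ (e i)).contDiff
  have hRc : ContDiff ℝ (⊤ : ℕ∞) R := contDiff_const.mul (hxc 4)
  have c₁ : ContDiff ℝ (⊤ : ℕ∞) G₁ := h₁.div hV hV0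
  have c₂ : ContDiff ℝ (⊤ : ℕ∞) G₂ := h₂.div hV hV0
  have c₃ : ContDiff ℝ (⊤ : ℕ∞) G₃ := h₃.div hV hV0
  have cL : ContDiff ℝ (⊤ : ℕ∞) fun v => log (V (R v)) := (hV.comp hRc).log fun v => hV0 _
  refine ⟨fun v => log (V (R v)) + 1 / 2 * (G₁ (R v) * (x 0 v ^ 2 + x 1 v ^ 2 - k (R v)))
    + G₂ (R v) * (x 2 v - r (R v)) + G₃ (R v) * (x 3 v - s (R v)), ?_,
    fun σ y N y1 y2 y3 y4 hN => ⟨?_, ?_⟩⟩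
  · fun_prop
  · have hRy : R y = σ := by simp only [hR, hx, y4]; field_simp
    simp [hRy, hx, y1, y2, y3, exp_log (hVp σ)]
  · have hRy : R y = σ := by simp only [hR, hx, y4]; field_simp
    have dx : ∀ i, HasFDerivAt (x i) (innerSL ℝ (e i)) y := fun i => (innerSL ℝ (e i)).hasFDerivAt
    have dR : HasFDerivAt R (ε⁻¹ • innerSL ℝ (e 4)) y := (dx 4).const_mul ε⁻¹
    have dc : ∀ {f : ℝ → ℝ}, ContDiff ℝ (⊤ : ℕ∞) f →
        HasFDerivAt (fun v => f (R v)) (deriv f σ • ε⁻¹ • innerSL ℝ (e 4)) y := fun {f} hf => by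
      have : HasDerivAt f (deriv f σ) (R y) := hRy ▸ (hf.differentiable hn σ).hasDerivAt
      exact this.comp_hasFDerivAt y dR
    have := ((((dc hV).log (hV0 _)).fun_add (((dc c₁).fun_mul ((((dx 0).pow 2).fun_add
      ((dx 1).pow 2)).fun_sub (dc hk))).const_mul (1 / 2))).fun_add
      ((dc c₂).fun_mul ((dx 2).fun_sub (dc hr)))).fun_add
      ((dc c₃).fun_mul ((dx 3).fun_sub (dc hs)))
    refine this.congr_fderiv ?_
    have := hV0 σ
    ext w
    simp [hRy, hx, y1, y2, y3, hN, hG₁, hG₂, hG₃]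
    field_simp
    ring

theorem pd_add {d : ℕ} {E : Type*} [NormedAddCommGroup E] [NormedSpace ℝ E]
    {f g : Sp d → E} {y : Sp d} (α : Fin (d + 1))
    (hf : DifferentiableAt ℝ f y) (hg : DifferentiableAt ℝ g y) :
    pd α (fun z => f z + g z) y = pd α f y + pd α g y := by
  unfold pd
  rw [fderiv_fun_add hf hg]
  simp

theorem dAlembert_add {d : ℕ} {E : Type*} [NormedAddCommGroup E] [NormedSpace ℝ E]
    {f g : Sp d → E} (hf : ContDiff ℝ (⊤ : ℕ∞) f) (hg : ContDiff ℝ (⊤ : ℕ∞) g) (y : Sp d) :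
    dAlembert (fun z => f z + g z) y = dAlembert f y + dAlembert g y := by
  have h1 : ∀ α, pd α (fun z => f z + g z) = fun z => pd α f z + pd α g z := fun α =>
    funext fun z => pd_add α (hf.differentiable (by simp) z) (hg.differentiable (by simp) z)
  have h2 : ∀ α, pd α (pd α fun z => f z + g z) y = pd α (pd α f) y + pd α (pd α g) y :=
    fun α => by
      rw [h1]
      exact pd_add α ((pd_contDiff hf α).differentiable (by simp) y)
        ((pd_contDiff hg α).differentiable (by simp) y)
  simp only [dAlembert, h2, Finset.sum_add_distrib]
  abel

theorem pd_sum_smul {d : ℕ} {ι E : Type*} [Fintype ι] [NormedAddCommGroup E] [NormedSpace ℝ E]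
    {f : ι → Sp d → ℝ} {y : Sp d} (e : ι → E) (α : Fin (d + 1))
    (hf : ∀ i, DifferentiableAt ℝ (f i) y) :
    pd α (fun z => ∑ i, f i z • e i) y = ∑ i, pd α (f i) y • e i := by
  unfold pd
  rw [(HasFDerivAt.fun_sum fun i _ => (hf i).hasFDerivAt.smul_const (e i)).fderiv]
  simp [_root_.sum_apply]

theorem dAlembert_sum_smul {d : ℕ} {ι E : Type*} [Fintype ι] [NormedAddCommGroup E]
    [NormedSpace ℝ E] {f : ι → Sp d → ℝ} (e : ι → E) (hf : ∀ i, ContDiff ℝ (⊤ : ℕ∞) (f i))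
    (y : Sp d) :
    dAlembert (fun z => ∑ i, f i z • e i) y = ∑ i, dAlembert (f i) y • e i := by
  have h1 : ∀ α, pd α (fun z => ∑ i, f i z • e i) = fun z => ∑ i, pd α (f i) z • e i := fun α =>
    funext fun z => pd_sum_smul e α fun i => (hf i).differentiable (by simp) z
  have h2 : ∀ α, pd α (pd α fun z => ∑ i, f i z • e i) y = ∑ i, pd α (pd α (f i)) y • e i :=
    fun α => by
      rw [h1]
      exact pd_sum_smul e α fun i => (pd_contDiff (hf i) α).differentiable (by simp) y
  simp only [dAlembert, h2, add_smul, neg_smul, Finset.sum_smul, Finset.sum_add_distrib,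
    Finset.sum_neg_distrib]
  rw [Finset.sum_comm]

theorem exists_contDiff_eq_log_one_sub {R : ℝ} (hR : R < 1) :
    ∃ ℓ : ℝ → ℝ, ContDiff ℝ (⊤ : ℕ∞) ℓ ∧ ∀ t < R, ℓ t = log (1 - t) ∧
      deriv ℓ t = -exp (-ℓ t) ∧ deriv (deriv ℓ) t = -exp (-2 * ℓ t) := by
  obtain ⟨φ, hφ, hφp, hφe⟩ := exists_pos_eq_id (sub_pos.2 hR)
  set ℓ : ℝ → ℝ := fun t => log (φ (1 - t)) with hℓ
  have hc : ContDiff ℝ (⊤ : ℕ∞) ℓ :=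
    (hφ.comp (contDiff_const.sub contDiff_id)).log fun t => (hφp _).ne'
  have e0 : ∀ t < R, ℓ t = log (1 - t) := fun t ht => by
    simp only [hℓ, hφe (1 - t) (by linarith)]
  have e1 : ∀ t < R, deriv ℓ t = -exp (-ℓ t) := fun t ht => by
    have hev : ℓ =ᶠ[nhds t] fun t => log (1 - t) := by
      filter_upwards [Iio_mem_nhds ht] with x hx using e0 x hx
    have h1 : 0 < 1 - t := by linarith
    rw [hev.deriv_eq, e0 t ht, exp_neg, exp_log h1,
      (((hasDerivAt_id' t).const_sub 1).log h1.ne').deriv]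
    ring
  refine ⟨ℓ, hc, fun t ht => ⟨e0 t ht, e1 t ht, ?_⟩⟩
  have hev : deriv ℓ =ᶠ[nhds t] fun t => -exp (-ℓ t) := by
    filter_upwards [Iio_mem_nhds ht] with x hx using e1 x hx
  rw [hev.deriv_eq, ((hc.differentiable (by simp) t).hasDerivAt.fun_neg.exp.fun_neg).deriv, e1 t ht,
    show -2 * ℓ t = -ℓ t + -ℓ t by ring, exp_add]
  ring

theorem profileOp_contDiff (a : ℝ) {f : ℝ → ℝ} (hf : ContDiff ℝ (⊤ : ℕ∞) f) :
    ContDiff ℝ (⊤ : ℕ∞) (profileOp a f) := by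
  have h1 := (contDiff_infty_iff_deriv.1 hf).2
  have h2 := (contDiff_infty_iff_deriv.1 h1).2
  unfold profileOp
  fun_prop

theorem rotProfileOp_contDiff (a ω : ℝ) {f g : ℝ → ℝ} (hf : ContDiff ℝ (⊤ : ℕ∞) f)
    (hg : ContDiff ℝ (⊤ : ℕ∞) g) : ContDiff ℝ (⊤ : ℕ∞) (rotProfileOp a ω f g) := by
  have h1 := (contDiff_infty_iff_deriv.1 hg).2
  have h2 := profileOp_contDiff a hf
  unfold rotProfileOp
  fun_prop

section

variable {ℓ b : ℝ → ℝ} {y : Sp 3} {σ : ℝ}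

theorem dAlembert_selfSimilar_exp (a : ℝ) (hℓ : ContDiff ℝ (⊤ : ℕ∞) ℓ)
    (hb : ContDiff ℝ (⊤ : ℕ∞) b) (h1 : deriv ℓ (y 0) = -exp (-ℓ (y 0)))
    (h2 : deriv (deriv ℓ) (y 0) = -exp (-2 * ℓ (y 0)))
    (hσ : radSq y * exp (-2 * ℓ (y 0)) = σ) :
    dAlembert (selfSimilar ℓ (fun t => exp (-a * ℓ t)) b) y =
      exp (-2 * ℓ (y 0)) * (exp (-a * ℓ (y 0)) * profileOp a b σ) := by
  have hd : ∀ t, HasDerivAt (fun t => exp (-a * ℓ t)) (deriv ℓ t * (-a * exp (-a * ℓ t))) t :=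
    fun t => (((hℓ.differentiable (by simp) t).hasDerivAt.const_mul (-a)).exp).congr_deriv
      (by ring)
  rw [dAlembert_selfSimilar (B := fun t => -a * exp (-a * ℓ t))
    (B' := fun t => -a * (-a * exp (-a * ℓ t))) hℓ (by fun_prop) (by fun_prop) hb
    (fun t => (hd t).deriv) (fun t => by rw [((hd t).const_mul (-a)).deriv]; ring) h1 h2 hσ]
  simp only [profileOp]
  push_cast
  ring

theorem hasDerivAt_exp_mul_cos_sin (a ω : ℝ) (hℓ : ContDiff ℝ (⊤ : ℕ∞) ℓ) (t : ℝ) :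
    HasDerivAt (fun t => exp (-a * ℓ t) * cos (ω * ℓ t)) (deriv ℓ t *
      (-a * (exp (-a * ℓ t) * cos (ω * ℓ t)) - ω * (exp (-a * ℓ t) * sin (ω * ℓ t)))) t ∧
    HasDerivAt (fun t => exp (-a * ℓ t) * sin (ω * ℓ t)) (deriv ℓ t *
      (-a * (exp (-a * ℓ t) * sin (ω * ℓ t)) + ω * (exp (-a * ℓ t) * cos (ω * ℓ t)))) t := by
  have h := (hℓ.differentiable (by simp) t).hasDerivAt
  exact ⟨((h.const_mul (-a)).exp.fun_mul (h.const_mul ω).cos).congr_deriv (by ring),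
    ((h.const_mul (-a)).exp.fun_mul (h.const_mul ω).sin).congr_deriv (by ring)⟩

theorem dAlembert_selfSimilar_cos (a ω : ℝ) (hℓ : ContDiff ℝ (⊤ : ℕ∞) ℓ)
    (hb : ContDiff ℝ (⊤ : ℕ∞) b) (h1 : deriv ℓ (y 0) = -exp (-ℓ (y 0)))
    (h2 : deriv (deriv ℓ) (y 0) = -exp (-2 * ℓ (y 0)))
    (hσ : radSq y * exp (-2 * ℓ (y 0)) = σ) :
    dAlembert (selfSimilar ℓ (fun t => exp (-a * ℓ t) * cos (ω * ℓ t)) b) y =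
      exp (-2 * ℓ (y 0)) * (exp (-a * ℓ (y 0)) * (cos (ω * ℓ (y 0)) *
        (profileOp a b σ + ω ^ 2 * b σ)
        - sin (ω * ℓ (y 0)) * (ω * (4 * σ * deriv b σ + (2 * a + 1) * b σ)))) := by
  have hd := hasDerivAt_exp_mul_cos_sin a ω hℓ
  rw [dAlembert_selfSimilar
    (B := fun t => -a * (exp (-a * ℓ t) * cos (ω * ℓ t)) - ω * (exp (-a * ℓ t) * sin (ω * ℓ t)))
    (B' := fun t => (a ^ 2 - ω ^ 2) * (exp (-a * ℓ t) * cos (ω * ℓ t))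
      + 2 * a * ω * (exp (-a * ℓ t) * sin (ω * ℓ t))) hℓ (by fun_prop) (by fun_prop) hb
    (fun t => (hd t).1.deriv)
    (fun t => by
      rw [(((hd t).1.const_mul (-a)).fun_sub ((hd t).2.const_mul ω)).deriv]; ring) h1 h2 hσ]
  simp only [profileOp]
  push_cast
  ring

theorem dAlembert_selfSimilar_sin (a ω : ℝ) (hℓ : ContDiff ℝ (⊤ : ℕ∞) ℓ)
    (hb : ContDiff ℝ (⊤ : ℕ∞) b) (h1 : deriv ℓ (y 0) = -exp (-ℓ (y 0)))
    (h2 : deriv (deriv ℓ) (y 0) = -exp (-2 * ℓ (y 0)))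
    (hσ : radSq y * exp (-2 * ℓ (y 0)) = σ) :
    dAlembert (selfSimilar ℓ (fun t => exp (-a * ℓ t) * sin (ω * ℓ t)) b) y =
      exp (-2 * ℓ (y 0)) * (exp (-a * ℓ (y 0)) * (sin (ω * ℓ (y 0)) *
        (profileOp a b σ + ω ^ 2 * b σ)
        + cos (ω * ℓ (y 0)) * (ω * (4 * σ * deriv b σ + (2 * a + 1) * b σ)))) := by
  have hd := hasDerivAt_exp_mul_cos_sin a ω hℓ
  rw [dAlembert_selfSimilar
    (B := fun t => -a * (exp (-a * ℓ t) * sin (ω * ℓ t)) + ω * (exp (-a * ℓ t) * cos (ω * ℓ t)))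
    (B' := fun t => (a ^ 2 - ω ^ 2) * (exp (-a * ℓ t) * sin (ω * ℓ t))
      - 2 * a * ω * (exp (-a * ℓ t) * cos (ω * ℓ t))) hℓ (by fun_prop) (by fun_prop) hb
    (fun t => (hd t).2.deriv)
    (fun t => by
      rw [(((hd t).2.const_mul (-a)).fun_add ((hd t).1.const_mul ω)).deriv]; ring) h1 h2 hσ]
  simp only [profileOp]
  push_cast
  ring

end

/-- The vector with coordinates `(x₀, …, x₄)` in the frame `e`, rotated by the angle `θ` in the plane
of the first two coordinates. -/
def rotatedVec {E : Type*} [AddCommGroup E] [Module ℝ E] (e : Fin 5 → E)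
    (θ x₀ x₁ x₂ x₃ x₄ : ℝ) : E :=
  (cos θ * x₀ - sin θ * x₁) • e 0 + (sin θ * x₀ + cos θ * x₁) • e 1 + x₂ • e 2 + x₃ • e 3 + x₄ • e 4

section

variable {E : Type*} [NormedAddCommGroup E] [InnerProductSpace ℝ E]

theorem inner_rotatedVec {e : Fin 5 → E} (θ x₀ x₁ x₂ x₃ x₄ : ℝ) (w : E) :
    ⟪rotatedVec e θ x₀ x₁ x₂ x₃ x₄, w⟫ = (cos θ * x₀ - sin θ * x₁) * ⟪e 0, w⟫
      + (sin θ * x₀ + cos θ * x₁) * ⟪e 1, w⟫ + x₂ * ⟪e 2, w⟫ + x₃ * ⟪e 3, w⟫ + x₄ * ⟪e 4, w⟫ := by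
  simp [rotatedVec, inner_add_left, inner_smul_left]

theorem inner_frame_rotatedVec {e : Fin 5 → E} (he : Orthonormal ℝ e) (θ x₀ x₁ x₂ x₃ x₄ : ℝ) :
    ⟪e 0, rotatedVec e θ x₀ x₁ x₂ x₃ x₄⟫ = cos θ * x₀ - sin θ * x₁ ∧
    ⟪e 1, rotatedVec e θ x₀ x₁ x₂ x₃ x₄⟫ = sin θ * x₀ + cos θ * x₁ ∧
    ⟪e 2, rotatedVec e θ x₀ x₁ x₂ x₃ x₄⟫ = x₂ ∧
    ⟪e 3, rotatedVec e θ x₀ x₁ x₂ x₃ x₄⟫ = x₃ ∧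
    ⟪e 4, rotatedVec e θ x₀ x₁ x₂ x₃ x₄⟫ = x₄ := by
  have := orthonormal_iff_ite.1 he
  simp [rotatedVec, inner_add_right, inner_smul_right, this, he.1]

theorem inner_rotatedVec_rotatedVec {e : Fin 5 → E} (he : Orthonormal ℝ e)
    (θ x₀ x₁ x₂ x₃ x₄ y₀ y₁ y₂ y₃ y₄ : ℝ) :
    ⟪rotatedVec e θ x₀ x₁ x₂ x₃ x₄, rotatedVec e θ y₀ y₁ y₂ y₃ y₄⟫
      = x₀ * y₀ + x₁ * y₁ + x₂ * y₂ + x₃ * y₃ + x₄ * y₄ := by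
  obtain ⟨h0, h1, h2, h3, h4⟩ := inner_frame_rotatedVec he θ y₀ y₁ y₂ y₃ y₄
  rw [inner_rotatedVec, h0, h1, h2, h3, h4]
  linear_combination (x₀ * y₀ + x₁ * y₁) * sin_sq_add_cos_sq θ

/-- The self-similar map `s ^ (-a) X(|x|² / s²)`, where `s = exp ℓ(t)`, with profile `X` rotated by
the angle `ω log s`. -/
def rotatingMap (e : Fin 5 → E) (a ε ω : ℝ) (P Q r s ℓ : ℝ → ℝ) (y : Sp 3) : E :=
  exp (-a * ℓ (y 0)) • rotatedVec e (ω * ℓ (y 0)) (P (radSq y * exp (-2 * ℓ (y 0))))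
    (Q (radSq y * exp (-2 * ℓ (y 0)))) (r (radSq y * exp (-2 * ℓ (y 0))))
    (s (radSq y * exp (-2 * ℓ (y 0)))) (ε * (radSq y * exp (-2 * ℓ (y 0))))

variable {e : Fin 5 → E} {a ε ω : ℝ} {P Q r s ℓ : ℝ → ℝ}

theorem rotatingMap_contDiff (hP : ContDiff ℝ (⊤ : ℕ∞) P) (hQ : ContDiff ℝ (⊤ : ℕ∞) Q)
    (hr : ContDiff ℝ (⊤ : ℕ∞) r) (hs : ContDiff ℝ (⊤ : ℕ∞) s) (hℓ : ContDiff ℝ (⊤ : ℕ∞) ℓ) :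
    ContDiff ℝ (⊤ : ℕ∞) (rotatingMap e a ε ω P Q r s ℓ) := by
  have h := radSq_contDiff (d := 3)
  unfold rotatingMap rotatedVec
  fun_prop

theorem dAlembert_rotatingMap (hP : ContDiff ℝ (⊤ : ℕ∞) P) (hQ : ContDiff ℝ (⊤ : ℕ∞) Q)
    (hr : ContDiff ℝ (⊤ : ℕ∞) r) (hs : ContDiff ℝ (⊤ : ℕ∞) s) (hℓ : ContDiff ℝ (⊤ : ℕ∞) ℓ)
    {y : Sp 3} (h1 : deriv ℓ (y 0) = -exp (-ℓ (y 0)))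
    (h2 : deriv (deriv ℓ) (y 0) = -exp (-2 * ℓ (y 0))) {σ : ℝ}
    (hσ : radSq y * exp (-2 * ℓ (y 0)) = σ) :
    dAlembert (rotatingMap e a ε ω P Q r s ℓ) y =
      (exp (-2 * ℓ (y 0)) * exp (-a * ℓ (y 0))) • rotatedVec e (ω * ℓ (y 0))
        (rotProfileOp a ω P Q σ) (rotProfileOp a (-ω) Q P σ) (profileOp a r σ) (profileOp a s σ)
        (profileOp a (fun x => ε * x) σ) := by
  have hε : ContDiff ℝ (⊤ : ℕ∞) fun x : ℝ => ε * x := by fun_prop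
  set A : ℝ → ℝ := fun t => exp (-a * ℓ t) with hA
  set C : ℝ → ℝ := fun t => exp (-a * ℓ t) * cos (ω * ℓ t) with hC
  set S : ℝ → ℝ := fun t => exp (-a * ℓ t) * sin (ω * ℓ t) with hS
  have cA : ContDiff ℝ (⊤ : ℕ∞) A := by fun_prop
  have cC : ContDiff ℝ (⊤ : ℕ∞) C := by fun_prop
  have cS : ContDiff ℝ (⊤ : ℕ∞) S := by fun_prop
  set f : Fin 5 → Sp 3 → ℝ := ![fun z => selfSimilar ℓ C P z - selfSimilar ℓ S Q z,
    fun z => selfSimilar ℓ S P z + selfSimilar ℓ C Q z, selfSimilar ℓ A r, selfSimilar ℓ A s,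
    selfSimilar ℓ A fun x => ε * x] with hf
  have hfc : ∀ i, ContDiff ℝ (⊤ : ℕ∞) (f i) := by
    intro i
    fin_cases i
    · exact (selfSimilar_contDiff hℓ cC hP).sub (selfSimilar_contDiff hℓ cS hQ)
    · exact (selfSimilar_contDiff hℓ cS hP).add (selfSimilar_contDiff hℓ cC hQ)
    · exact selfSimilar_contDiff hℓ cA hr
    · exact selfSimilar_contDiff hℓ cA hs
    · exact selfSimilar_contDiff hℓ cA hε
  have hmap : rotatingMap e a ε ω P Q r s ℓ = fun z => ∑ i, f i z • e i := by
    funext z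
    simp only [hf, rotatingMap, rotatedVec, Fin.sum_univ_five, selfSimilar, hA, hC, hS,
      Matrix.cons_val]
    module
  rw [hmap, dAlembert_sum_smul e hfc]
  simp only [hf, Fin.sum_univ_five, Matrix.cons_val]
  rw [dAlembert_sub (selfSimilar_contDiff hℓ cC hP) (selfSimilar_contDiff hℓ cS hQ),
    dAlembert_add (selfSimilar_contDiff hℓ cS hP) (selfSimilar_contDiff hℓ cC hQ),
    dAlembert_selfSimilar_cos a ω hℓ hP h1 h2 hσ, dAlembert_selfSimilar_cos a ω hℓ hQ h1 h2 hσ,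
    dAlembert_selfSimilar_sin a ω hℓ hP h1 h2 hσ, dAlembert_selfSimilar_sin a ω hℓ hQ h1 h2 hσ,
    dAlembert_selfSimilar_exp a hℓ hr h1 h2 hσ, dAlembert_selfSimilar_exp a hℓ hs h1 h2 hσ,
    dAlembert_selfSimilar_exp a hℓ hε h1 h2 hσ]
  simp only [rotatedVec, rotProfileOp]
  module

end

theorem exists_potential_and_blowup {m : ℕ} {a q : ℝ} (ha : 0 < a) (ha2 : a < 1 / 2)
    (hq : q = 2 + 2 / a) (hm : 5 ≤ m) :
    ∃ (F : Em m → ℝ) (φ : Sp 3 → Em m), ContDiff ℝ (⊤ : ℕ∞) F ∧ (∀ v, 0 < F v) ∧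
      (∀ l : ℝ, 1 ≤ l → ∀ v, 1 ≤ ‖v‖ → F (l • v) = l ^ q * F v) ∧
      (∀ R < 1, ∃ U : Sp 3 → Em m, ContDiff ℝ (⊤ : ℕ∞) U ∧ ∀ y, y 0 < R → U y = φ y) ∧
      (∀ y : Sp 3, 0 ≤ y 0 → y 0 < 1 → radSq y ≤ (1 - y 0) ^ 2 →
        dAlembert φ y = gradient F (φ y)) ∧
      ∀ K, ∃ t : ℝ, 0 < t ∧ t < 1 ∧ K < ‖φ (Fin.cons t 0)‖ := by
  obtain ⟨ε, ω, V, P, Q, r, s, hε, hV, hP, hQ, hr, hs, hVp, hk, hX⟩ := exists_profile ha ha2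
  obtain ⟨e, he⟩ : ∃ e : Fin 5 → Em m, Orthonormal ℝ e :=
    ⟨_, (EuclideanSpace.basisFun (Fin m) ℝ).orthonormal.comp _ (Fin.castLE_injective hm)⟩
  set A := rotProfileOp a ω P Q with hA
  set B := rotProfileOp a (-ω) Q P with hB
  have cA : ContDiff ℝ (⊤ : ℕ∞) A := rotProfileOp_contDiff a ω hP hQ
  have cB : ContDiff ℝ (⊤ : ℕ∞) B := rotProfileOp_contDiff a (-ω) hQ hP
  have ck : ContDiff ℝ (⊤ : ℕ∞) fun σ => P σ ^ 2 + Q σ ^ 2 := by fun_prop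
  have dk : ∀ σ, deriv (fun σ => P σ ^ 2 + Q σ ^ 2) σ
      = 2 * (P σ * deriv P σ + Q σ * deriv Q σ) := fun σ => by
    rw [(((hP.differentiable (by simp) σ).hasDerivAt.fun_pow 2).fun_add
      ((hQ.differentiable (by simp) σ).hasDerivAt.fun_pow 2)).deriv]
    norm_num
    ring
  obtain ⟨H, hH, hHX⟩ := exists_angular_potential e hε.ne' hV ck hr hs
    (show ContDiff ℝ (⊤ : ℕ∞) fun σ => (P σ * A σ + Q σ * B σ) / (P σ ^ 2 + Q σ ^ 2) from
      ((hP.mul cA).add (hQ.mul cB)).div ck fun σ => (hk σ).ne')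
    (profileOp_contDiff a hr) (profileOp_contDiff a hs) hVp
  obtain ⟨F, hF, hFp, hFh, hFg⟩ := exists_homogeneous_potential q hH
  have hnorm : ∀ σ ∈ Set.Icc (0 : ℝ) 1, ∀ θ,
      ‖rotatedVec e θ (P σ) (Q σ) (r σ) (s σ) (ε * σ)‖ = 1 := fun σ hσ θ => by
    rw [norm_eq_sqrt_real_inner, inner_rotatedVec_rotatedVec he, Real.sqrt_eq_one]
    linear_combination (hX σ hσ).1
  have hgrad : ∀ σ ∈ Set.Icc (0 : ℝ) 1, ∀ θ ρ : ℝ, 1 ≤ ρ →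
      gradient F (ρ • rotatedVec e θ (P σ) (Q σ) (r σ) (s σ) (ε * σ))
        = ρ ^ (q - 1) • rotatedVec e θ (A σ) (B σ) (profileOp a r σ) (profileOp a s σ)
          (profileOp a (fun x => ε * x) σ) := fun σ hσ θ ρ hρ => by
    obtain ⟨-, x2, x3, x4⟩ := hX σ hσ
    obtain ⟨y0, y1, y2, y3, y4⟩ := inner_frame_rotatedVec he θ (P σ) (Q σ) (r σ) (s σ) (ε * σ)
    have hk0 := (hk σ).ne'
    obtain ⟨z1, z2⟩ := hHX σ _ (rotatedVec e θ (A σ) (B σ) (profileOp a r σ) (profileOp a s σ)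
      (profileOp a (fun x => ε * x) σ))
      (by rw [y0, y1]; linear_combination (P σ ^ 2 + Q σ ^ 2) * sin_sq_add_cos_sq θ) y2 y3 y4
      (fun w => by
        have a1 : (P σ * A σ + Q σ * B σ) / (P σ ^ 2 + Q σ ^ 2) * P σ = A σ := by
          rw [div_mul_eq_mul_div, div_eq_iff hk0]
          linear_combination Q σ * x2
        have a2 : (P σ * A σ + Q σ * B σ) / (P σ ^ 2 + Q σ ^ 2) * Q σ = B σ := by
          rw [div_mul_eq_mul_div, div_eq_iff hk0]
          linear_combination -P σ * x2
        rw [inner_rotatedVec, y0, y1, dk, ← x4]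
        set g := (P σ * A σ + Q σ * B σ) / (P σ ^ 2 + Q σ ^ 2)
        rw [← a1, ← a2]
        field_simp
        ring)
    refine hFg ρ (V σ) _ _ hρ (hnorm σ hσ θ) z1 z2 ?_
    rw [inner_rotatedVec_rotatedVec he, hq]
    linear_combination x3
  refine ⟨F, rotatingMap e a ε ω P Q r s fun t => log (1 - t), hF, hFp, hFh, fun R hR => ?_,
    fun y hy0 hy1 hy => ?_, fun K => ?_⟩
  · obtain ⟨ℓ, hℓ, hℓe⟩ := exists_contDiff_eq_log_one_sub hR
    refine ⟨rotatingMap e a ε ω P Q r s ℓ, rotatingMap_contDiff hP hQ hr hs hℓ, fun y hy => ?_⟩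
    simp only [rotatingMap, (hℓe _ hy).1]
  · obtain ⟨R, hyR, hR⟩ := exists_between hy1
    obtain ⟨ℓ, hℓ, hℓe⟩ := exists_contDiff_eq_log_one_sub hR
    have hev : rotatingMap e a ε ω P Q r s (fun t => log (1 - t)) =ᶠ[nhds y]
        rotatingMap e a ε ω P Q r s ℓ := by
      filter_upwards [(continuous_apply 0).continuousAt.eventually_lt_const hyR] with z hz
      simp only [rotatingMap, (hℓe _ hz).1]
    obtain ⟨h0, h1, h2⟩ := hℓe _ hyR
    have hs0 : 0 < 1 - y 0 := by linarith
    have hE : exp (-2 * ℓ (y 0)) = ((1 - y 0) ^ 2)⁻¹ := by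
      rw [h0, ← log_rpow hs0, exp_log (rpow_pos_of_pos hs0 _), rpow_neg hs0.le]
      norm_num
    have hσ : radSq y * exp (-2 * ℓ (y 0)) ∈ Set.Icc (0 : ℝ) 1 := by
      rw [hE, ← div_eq_mul_inv]
      exact ⟨div_nonneg (Finset.sum_nonneg fun i _ => sq_nonneg _) (by positivity),
        div_le_one_of_le₀ hy (by positivity)⟩
    have hρ : 1 ≤ exp (-a * ℓ (y 0)) := by
      rw [one_le_exp_iff, h0]
      nlinarith [log_nonpos hs0.le (by linarith)]
    rw [hev.dAlembert_eq, hev.eq_of_nhds, dAlembert_rotatingMap hP hQ hr hs hℓ h1 h2 rfl,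
      rotatingMap, hgrad _ hσ _ _ hρ, ← exp_mul, ← exp_add, hq]
    congr 2
    field_simp
    ring
  · set T := (|K| + 1) / a with hT
    have hTp : 0 < T := by positivity
    have h1 : exp (-T) < 1 := exp_lt_one_iff.2 (by linarith)
    refine ⟨1 - exp (-T), by linarith, by linarith [exp_pos (-T)], ?_⟩
    have h2 : a * T = |K| + 1 := by rw [hT]; field_simp
    have h3 : radSq (Fin.cons (1 - exp (-T)) 0 : Sp 3) = 0 := by simp [radSq]
    rw [rotatingMap, norm_smul, h3, zero_mul, hnorm 0 (by simp)]
    simp only [Fin.cons_zero, sub_sub_cancel, log_exp, mul_one, norm_eq_abs, abs_exp]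
    rw [neg_mul_neg, h2]
    linarith [add_one_le_exp (|K| + 1), le_abs_self K]

/-- Theorem 1.2, finite time blowup.  For `d = 3`, `p > 5` and `m ≥ 40`
there is a defocusing smooth potential `F : ℝ^m → ℝ`, homogeneous of order `p+1` outside
the unit ball, and smooth initial data `u₀, u₁`, for which no global smooth solution of
`□u = ∇F(u)` with this initial data exists. -/
theorem stmt0 (p : ℝ) (hp : 5 < p) (m : ℕ) (hm : 40 ≤ m) :
    ∃ F : Em m → ℝ,
      -- `F` is a smooth potential
      ContDiff ℝ (⊤ : ℕ∞) F ∧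
      -- `F` is defocusing
      (∀ v : Em m, v ≠ 0 → 0 < F v) ∧
      -- `F` is homogeneous of order `p+1` outside of the unit ball
      (∀ l : ℝ, 1 ≤ l → ∀ v : Em m, 1 ≤ ‖v‖ → F (l • v) = l ^ (p + 1) * F v) ∧
      ∃ u₀ u₁ : (Fin 3 → ℝ) → Em m,
        ContDiff ℝ (⊤ : ℕ∞) u₀ ∧ ContDiff ℝ (⊤ : ℕ∞) u₁ ∧
        -- there is no global smooth solution with this initial data
        ¬ ∃ u : Sp 3 → Em m,
            ContDiff ℝ (⊤ : ℕ∞) u ∧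
            (∀ y : Sp 3, dAlembert u y = gradient F (u y)) ∧
            (∀ x : Fin 3 → ℝ, u (Fin.cons (0 : ℝ) x) = u₀ x) ∧
            (∀ x : Fin 3 → ℝ, pd 0 u (Fin.cons (0 : ℝ) x) = u₁ x) := by
  have hp1 : 0 < p - 1 := by linarith
  obtain ⟨F, φ, hF, hFp, hFh, h1, h2, h3⟩ := exists_potential_and_blowup (a := 2 / (p - 1))
    (q := p + 1) (m := m) (by positivity) (by rw [div_lt_div_iff₀ hp1 two_pos]; linarith)
    (by field_simp; ring) (by lia)
  exact ⟨F, hF, fun v _ => hFp v, hFh, exists_data_without_global_solution hF h1 h2 h3⟩
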